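/- The set R of values attained infinitely many times by the sequence d(n+1)/d(n) contains the multiplicative subgroup G of the positive rationals generated by the set {f(x, y) : x, y positive integers}, where f(x, y) = (x+1)(y+1)/(x+y+1). -/

import Mathlib

/-- `d n` is the number of positive divisors of `n`. -/
def d (n : ℕ) : ℕ := n.divisors.card

/-- `R` is the set of (rational) values attained infinitely many times by the
sequence `d(n+1)/d(n)` over positive integers `n`. -/
def R : Set ℚ :=
  {q | {n : ℕ | 0 < n ∧ (d (n + 1) : ℚ) / (d n : ℚ) = q}.Infinite}

/-- The multiplicative group of positive rational numbers. -/
abbrev Qpos := {q : ℚ // 0 < q}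

/-- `f x y = (x+1)(y+1)/(x+y+1)`. -/
def f (x y : ℕ) : ℚ := ((x + 1 : ℚ) * (y + 1)) / (x + y + 1)

/-- `G` is the subgroup of the positive rationals generated by
`{f x y : x, y positive integers}`. -/
def G : Subgroup Qpos :=
  Subgroup.closure {g : Qpos | ∃ x y : ℕ, 0 < x ∧ 0 < y ∧ (g : ℚ) = f x y}

open Finset

/-- The factor by which a prime with exponents `a` and `b` in two integers contributes to the
ratio of their divisor counts, after removal of the common part. -/
def valRatio (a b : ℕ) : ℚ := ((b - a + 1 : ℕ) : ℚ) / ((a - b + 1 : ℕ) : ℚ)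

lemma valRatio_self (a : ℕ) : valRatio a a = 1 := by simp [valRatio]

lemma valRatio_of_le {a b : ℕ} (h : a ≤ b) : valRatio a b = ((b - a : ℕ) : ℚ) + 1 := by
  simp [valRatio, Nat.sub_eq_zero_of_le h]

lemma valRatio_of_ge {a b : ℕ} (h : b ≤ a) : valRatio a b = (((a - b : ℕ) : ℚ) + 1)⁻¹ := by
  simp [valRatio, Nat.sub_eq_zero_of_le h]

lemma valRatio_reverse {a b D : ℕ} (ha : a ≤ D) (hb : b ≤ D) :
    valRatio (D - a) (D - b) = (valRatio a b)⁻¹ := by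
  have h1 : D - b - (D - a) = a - b := by omega
  have h2 : D - a - (D - b) = b - a := by omega
  simp [valRatio, h1, h2]

/-- `g` can be realised, for every `N`, by linearly many bounded exponent patterns on `N` indices
as the common ratio of all pairs of indices. -/
def HasDesign (g : ℚ) : Prop :=
  ∃ B C : ℕ, ∀ N : ℕ, ∃ v : ℕ → ℕ → ℕ, (∀ s i, v s i ≤ C) ∧
    ∀ i j, i < j → j < N → ∏ s ∈ range (B * N), valRatio (v s i) (v s j) = g

lemma hasDesign_one : HasDesign 1 :=
  ⟨0, 0, fun N => ⟨fun _ _ => 0, by simp, by simp⟩⟩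

lemma HasDesign.mul {g₁ g₂ : ℚ} (h₁ : HasDesign g₁) (h₂ : HasDesign g₂) :
    HasDesign (g₁ * g₂) := by
  obtain ⟨B₁, C₁, h₁⟩ := h₁
  obtain ⟨B₂, C₂, h₂⟩ := h₂
  refine ⟨B₁ + B₂, max C₁ C₂, fun N => ?_⟩
  obtain ⟨v₁, b₁, e₁⟩ := h₁ N
  obtain ⟨v₂, b₂, e₂⟩ := h₂ N
  refine ⟨fun s i => if s < B₁ * N then v₁ s i else v₂ (s - B₁ * N) i, fun s i => ?_,
    fun i j hij hj => ?_⟩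
  · dsimp only
    split_ifs
    · exact (b₁ _ _).trans (le_max_left _ _)
    · exact (b₂ _ _).trans (le_max_right _ _)
  · rw [add_mul, prod_range_add, ← e₁ i j hij hj, ← e₂ i j hij hj]
    congr 1
    · refine prod_congr rfl fun s hs => ?_
      simp [mem_range.1 hs]
    · refine prod_congr rfl fun s _ => ?_
      simp

lemma HasDesign.inv {g : ℚ} (h : HasDesign g) : HasDesign g⁻¹ := by
  obtain ⟨B, C, h⟩ := h
  refine ⟨B, C, fun N => ?_⟩
  obtain ⟨v, b, e⟩ := h N
  refine ⟨fun s i => C - v s i, fun s i => Nat.sub_le _ _, fun i j hij hj => ?_⟩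
  rw [← e i j hij hj, ← prod_inv_distrib]
  exact prod_congr rfl fun s _ => valRatio_reverse (b _ _) (b _ _)

lemma prod_valRatio_three_step (x y N i j : ℕ) (hij : i < j) (hj : j < N) :
    ∏ s ∈ range N, valRatio (if i < s then 0 else if i = s then x else x + y)
      (if j < s then 0 else if j = s then x else x + y) =
      f x y * ∏ s ∈ range N, (if i < s ∧ s ≤ j then ((x : ℚ) + y + 1) else 1) := by
  have hpos : ((x : ℚ) + y + 1) ≠ 0 := by positivity
  have key : ∀ s ∈ range N, valRatio (if i < s then 0 else if i = s then x else x + y)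
      (if j < s then 0 else if j = s then x else x + y) =
      (if s = i then ((y : ℚ) + 1) else 1) * (if s = j then ((x : ℚ) + 1) / (x + y + 1) else 1) *
        (if i < s ∧ s ≤ j then ((x : ℚ) + y + 1) else 1) := by
    intro s _
    rcases lt_trichotomy s i with h | h | h
    · have h1 : ¬ i < s := by omega
      have h2 : ¬ i = s := by omega
      have h3 : ¬ j < s := by omega
      have h4 : ¬ j = s := by omega
      have h5 : ¬ s = i := by omega
      have h6 : ¬ s = j := by omega
      simp [h1, h2, h3, h4, h5, h6, valRatio_self]
    · subst h
      have h3 : ¬ j < s := by omega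
      have h4 : ¬ j = s := by omega
      have h6 : ¬ s = j := by omega
      simp [h3, h4, h6, valRatio_of_le]
    · have h5 : ¬ s = i := by omega
      rcases lt_trichotomy s j with h' | h' | h'
      · have h3 : ¬ j < s := by omega
        have h4 : ¬ j = s := by omega
        have h6 : ¬ s = j := by omega
        simp [h, h3, h4, h5, h6, h'.le, valRatio_of_le]
      · subst h'
        simp [h, h5, valRatio_of_le]
        field_simp
      · have h6 : ¬ s = j := by omega
        simp [h, h', h5, h6, valRatio_self]
  rw [prod_congr rfl key, prod_mul_distrib, prod_mul_distrib, prod_ite_eq', prod_ite_eq']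
  have hi : i ∈ range N := mem_range.2 (hij.trans hj)
  have hj' : j ∈ range N := mem_range.2 hj
  simp only [hi, hj', if_true, f]
  ring

lemma hasDesign_f (x y : ℕ) : HasDesign (f x y) := by
  refine ⟨2, x + y, fun N => ⟨fun s i => if s < N then
    (if i < s then 0 else if i = s then x else x + y) else
    (if i < s - N then x + y else 0), fun s i => ?_, fun i j hij hj => ?_⟩⟩
  · dsimp only
    split_ifs <;> omega
  have hpos : ((x : ℚ) + y + 1) ≠ 0 := by positivity
  have h₁ : ∏ s ∈ range N, valRatio
      (if s < N then (if i < s then 0 else if i = s then x else x + y) else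
        (if i < s - N then x + y else 0))
      (if s < N then (if j < s then 0 else if j = s then x else x + y) else
        (if j < s - N then x + y else 0)) =
      f x y * ∏ s ∈ range N, (if i < s ∧ s ≤ j then ((x : ℚ) + y + 1) else 1) := by
    rw [← prod_valRatio_three_step x y N i j hij hj]
    refine prod_congr rfl fun s hs => ?_
    simp only [mem_range.1 hs, if_true]
  have h₂ : ∀ s ∈ range N, valRatio
      (if N + s < N then (if i < N + s then 0 else if i = N + s then x else x + y) else
        (if i < N + s - N then x + y else 0))
      (if N + s < N then (if j < N + s then 0 else if j = N + s then x else x + y) else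
        (if j < N + s - N then x + y else 0)) =
      (if i < s ∧ s ≤ j then ((x : ℚ) + y + 1) else 1)⁻¹ := by
    intro s _
    have h0 : ¬ N + s < N := by omega
    simp only [h0, if_false, Nat.add_sub_cancel_left]
    rcases lt_or_ge i s with h | h
    · rcases lt_or_ge j s with h' | h'
      · simp [h, h', valRatio_self]
      · simp [h, h', h'.not_gt, valRatio_of_ge]
    · have h3 : ¬ j < s := by omega
      simp [h.not_gt, h3, valRatio_self]
  dsimp only
  rw [two_mul, prod_range_add, h₁, prod_congr rfl h₂, prod_inv_distrib, mul_assoc,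
    mul_inv_cancel₀, mul_one]
  refine prod_ne_zero_iff.2 fun s _ => ?_
  split_ifs
  · exact hpos
  · exact one_ne_zero

lemma hasDesign_of_mem_G (g : Qpos) (hg : g ∈ G) : HasDesign (g : ℚ) := by
  induction hg using Subgroup.closure_induction with
  | mem g hg =>
    obtain ⟨x, y, -, -, h⟩ := hg
    rw [h]
    exact hasDesign_f x y
  | one => exact hasDesign_one
  | mul a b _ _ ha hb => exact ha.mul hb
  | inv a _ ha => exact ha.inv

/-- A design whose first `2 * N` patterns are injective. -/
lemma HasDesign.exists_injective_prefix {g : ℚ} (h : HasDesign g) :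
    ∃ B C : ℕ, 2 ≤ B ∧ ∀ N : ℕ, ∃ v : ℕ → ℕ → ℕ, (∀ s i, v s i ≤ N + C) ∧
      (∀ s < 2 * N, ∀ i < N, ∀ j < N, v s i = v s j → i = j) ∧
      ∀ i j, i < j → j < N → ∏ s ∈ range (B * N), valRatio (v s i) (v s j) = g := by
  obtain ⟨B, C, h⟩ := h
  refine ⟨2 + B, C, Nat.le_add_right _ _, fun N => ?_⟩
  obtain ⟨v, b, e⟩ := h N
  refine ⟨fun s i => if s < 2 * N then (if s < N then min i N else N - i) else v (s - 2 * N) i,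
    fun s i => ?_, fun s hs i hi j hj hv => ?_, fun i j hij hj => ?_⟩
  · dsimp only
    have := b (s - 2 * N) i
    split_ifs <;> omega
  · simp only [hs, if_true] at hv
    split_ifs at hv <;> omega
  · rw [add_mul, prod_range_add, two_mul, prod_range_add]
    have h₁ : ∀ s ∈ range N, valRatio
        (if s < N + N then (if s < N then min i N else N - i) else v (s - (N + N)) i)
        (if s < N + N then (if s < N then min j N else N - j) else v (s - (N + N)) j) =
        valRatio i j := by
      intro s hs
      have hs := mem_range.1 hs
      have h0 : s < N + N := by omega
      simp only [hs, h0, if_true]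
      rw [min_eq_left (by omega), min_eq_left hj.le]
    have h₂ : ∀ s ∈ range N, valRatio
        (if N + s < N + N then (if N + s < N then min i N else N - i) else v (N + s - (N + N)) i)
        (if N + s < N + N then (if N + s < N then min j N else N - j) else v (N + s - (N + N)) j) =
        (valRatio i j)⁻¹ := by
      intro s hs
      have hs := mem_range.1 hs
      have h0 : N + s < N + N := by omega
      have h1 : ¬ N + s < N := by omega
      simp only [h0, h1, if_true, if_false]
      exact valRatio_reverse (by omega) (by omega)
    have h₃ : ∀ s ∈ range (B * N), valRatio
        (if N + N + s < N + N then (if N + N + s < N then min i N else N - i)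
          else v (N + N + s - (N + N)) i)
        (if N + N + s < N + N then (if N + N + s < N then min j N else N - j)
          else v (N + N + s - (N + N)) j) =
        valRatio (v s i) (v s j) := by
      intro s hs
      simp
    rw [prod_congr rfl h₁, prod_congr rfl h₂, prod_congr rfl h₃, e i j hij hj, prod_const,
      prod_const, ← mul_pow, mul_inv_cancel₀, one_pow, one_mul]
    simp [valRatio]
    constructor <;> positivity

lemma card_primes_dyadic_le (k : ℕ) :
    k * #{p ∈ Ioc (2 ^ k) (2 ^ (k + 1)) | p.Prime} ≤ 2 ^ (k + 2) := by
  set P := {p ∈ Ioc (2 ^ k) (2 ^ (k + 1)) | p.Prime} with hP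
  have h1 : (2 ^ k) ^ #P ≤ ∏ p ∈ P, p :=
    pow_card_le_prod _ _ _ fun p hp => (mem_Ioc.1 (mem_filter.1 hp).1).1.le
  have h2 : ∏ p ∈ P, p ≤ primorial (2 ^ (k + 1)) := by
    refine prod_le_prod_of_subset_of_one_le' (fun p hp => ?_) fun p hp _ => ?_
    · have := mem_filter.1 hp
      exact mem_filter.2 ⟨mem_range.2 (Nat.lt_succ_of_le (mem_Ioc.1 this.1).2), this.2⟩
    · exact (mem_filter.1 hp).2.one_le
  have h3 := primorial_le_four_pow (2 ^ (k + 1))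
  have h4 : (4 : ℕ) ^ 2 ^ (k + 1) = 2 ^ 2 ^ (k + 2) := by
    rw [show (4 : ℕ) = 2 ^ 2 by norm_num, ← pow_mul]
    congr 1
    ring
  have h5 : 2 ^ (k * #P) ≤ 2 ^ 2 ^ (k + 2) := by
    rw [pow_mul, ← h4]
    exact h1.trans (h2.trans h3)
  exact (Nat.pow_le_pow_iff_right (by norm_num)).1 h5

lemma sum_primes_inv_le_harmonic (k : ℕ) :
    ∑ p ∈ Ioc (0 : ℕ) (2 ^ (k + 1)) with p.Prime, (1 / p : ℝ) ≤ 4 * (harmonic k : ℝ) + 1 / 2 := by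
  induction k with
  | zero =>
    have : {p ∈ Ioc 0 (2 ^ (0 + 1)) | p.Prime} = {2} := by decide
    rw [this]
    simp
  | succ k ih =>
    have hsplit : {p ∈ Ioc 0 (2 ^ (k + 1 + 1)) | p.Prime} =
        {p ∈ Ioc 0 (2 ^ (k + 1)) | p.Prime} ∪
          {p ∈ Ioc (2 ^ (k + 1)) (2 ^ (k + 1 + 1)) | p.Prime} := by
      rw [← filter_union, Ioc_union_Ioc_eq_Ioc (Nat.zero_le _)
        (Nat.pow_le_pow_right (by norm_num) (Nat.le_succ _))]
    have hdisj : Disjoint {p ∈ Ioc 0 (2 ^ (k + 1)) | p.Prime}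
        {p ∈ Ioc (2 ^ (k + 1)) (2 ^ (k + 1 + 1)) | p.Prime} := by
      refine disjoint_left.2 fun p h1 h2 => ?_
      simp only [mem_filter, mem_Ioc] at h1 h2
      omega
    rw [hsplit, sum_union hdisj, harmonic_succ]
    have hblock : ∑ p ∈ Ioc (2 ^ (k + 1) : ℕ) (2 ^ (k + 1 + 1)) with p.Prime, (1 / p : ℝ) ≤
        4 * ((k : ℝ) + 1)⁻¹ := by
      have hcard := card_primes_dyadic_le (k + 1)
      have h1 : ∑ p ∈ Ioc (2 ^ (k + 1) : ℕ) (2 ^ (k + 1 + 1)) with p.Prime, (1 / p : ℝ) ≤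
          #{p ∈ Ioc (2 ^ (k + 1)) (2 ^ (k + 1 + 1)) | p.Prime} • (1 / (2 : ℝ) ^ (k + 1)) := by
        refine sum_le_card_nsmul _ _ _ fun p hp => ?_
        have := (mem_Ioc.1 (mem_filter.1 hp).1).1.le
        have : ((2 : ℝ) ^ (k + 1)) ≤ p := by exact_mod_cast this
        exact one_div_le_one_div_of_le (by positivity) this
      refine h1.trans ?_
      have h2 : ((k : ℝ) + 1) * #{p ∈ Ioc (2 ^ (k + 1)) (2 ^ (k + 1 + 1)) | p.Prime} ≤
          4 * 2 ^ (k + 1) := by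
        have : (((k + 1) * #{p ∈ Ioc (2 ^ (k + 1)) (2 ^ (k + 1 + 1)) | p.Prime} : ℕ) : ℝ) ≤
          ((2 ^ (k + 1 + 2) : ℕ) : ℝ) := by exact_mod_cast hcard
        push_cast at this
        calc _ ≤ _ := this
          _ = _ := by ring
      rw [nsmul_eq_mul, mul_one_div, ← div_eq_mul_inv, div_le_div_iff₀ (by positivity)
        (by positivity)]
      linarith
    push_cast
    linarith

lemma sum_primes_inv_le (m : ℕ) :
    ∑ p ∈ Ioc (0 : ℕ) (2 ^ 2 ^ m) with p.Prime, (1 / p : ℝ) ≤ 4 * m + 5 := by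
  obtain ⟨k, hk⟩ : ∃ k, 2 ^ m = k + 1 := Nat.exists_eq_succ_of_ne_zero (by positivity)
  rw [hk]
  refine (sum_primes_inv_le_harmonic k).trans ?_
  have h1 := harmonic_le_one_add_log k
  have h2 : Real.log k ≤ m := by
    rcases Nat.eq_zero_or_pos k with rfl | hk0
    · simp
    · have : Real.log k ≤ Real.log ((2 : ℝ) ^ m) := by
        refine Real.log_le_log (by exact_mod_cast hk0) ?_
        have : k ≤ 2 ^ m := by omega
        exact_mod_cast this
      rw [Real.log_pow] at this
      have h3 := Real.log_two_lt_d9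
      have h4 : (0 : ℝ) ≤ m := by positivity
      nlinarith
  linarith

lemma abs_card_dvd_linear_sub_le {A D : ℕ} (B X : ℕ) (hD : 0 < D) (h : A.Coprime D) :
    |(#{t ∈ range X | D ∣ A * t + B} : ℝ) - X / D| ≤ 1 := by
  have : NeZero D := ⟨hD.ne'⟩
  obtain ⟨u, hu⟩ := (ZMod.isUnit_iff_coprime A D).2 h
  set r := ((-B : ZMod D) * (u⁻¹ : (ZMod D)ˣ)).val with hr
  have hiff : ∀ t : ℕ, D ∣ A * t + B ↔ t ≡ r [MOD D] := by
    intro t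
    rw [← ZMod.natCast_eq_natCast_iff, ← ZMod.natCast_eq_zero_iff, hr, ZMod.natCast_zmod_val,
      Units.eq_mul_inv_iff_mul_eq, hu]
    push_cast
    rw [add_eq_zero_iff_eq_neg, mul_comm]
  have hcount : #{t ∈ range X | D ∣ A * t + B} =
      X / D + if r % D < X % D then 1 else 0 := by
    rw [← Nat.count_modEq_card _ hD, Nat.count_eq_card_filter_range]
    congr 1
    exact filter_congr fun t _ => hiff t
  have hX : (X : ℝ) / D = (X / D : ℕ) + ((X % D : ℕ) : ℝ) / D := by
    have : (X : ℝ) = D * (X / D : ℕ) + (X % D : ℕ) := by exact_mod_cast (Nat.div_add_mod X D).symm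
    have hD' : (D : ℝ) ≠ 0 := by positivity
    field_simp
    linarith
  have h1 : (0 : ℝ) ≤ ((X % D : ℕ) : ℝ) / D := by positivity
  have h2 : ((X % D : ℕ) : ℝ) / D ≤ 1 := by
    rw [div_le_one (by positivity)]
    exact_mod_cast (Nat.mod_lt X hD).le
  rw [hcount, hX, abs_le]
  push_cast
  split_ifs <;> constructor <;> linarith

/-- The Turán–Kubilius inequality for a linear form and a set of primes not dividing its leading
coefficient. -/
lemma sum_sq_card_dvd_sub_le {A B X : ℕ} {S : Finset ℕ} (hS : ∀ p ∈ S, p.Prime ∧ A.Coprime p)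
    (hX : #S ^ 2 ≤ X) :
    ∑ t ∈ range X, ((#{p ∈ S | p ∣ A * t + B} : ℝ) - ∑ p ∈ S, (1 / p : ℝ)) ^ 2 ≤
      X * (∑ p ∈ S, (1 / p : ℝ) + 3) := by
  set μ := ∑ p ∈ S, (1 / p : ℝ) with hμ
  have hμ0 : 0 ≤ μ := sum_nonneg fun p _ => by positivity
  have hμS : μ ≤ #S := by
    have : μ ≤ #S • (1 : ℝ) := sum_le_card_nsmul _ _ _ fun p hp => by
      have : (1 : ℝ) ≤ p := by exact_mod_cast (hS p hp).1.one_le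
      exact (div_le_one (by linarith)).2 this
    simpa using this
  have hXS : ((#S : ℝ)) ^ 2 ≤ X := by exact_mod_cast hX
  set c : ℕ → ℕ → ℝ := fun p t => if p ∣ A * t + B then 1 else 0 with hc
  have hcard : ∀ t, (#{p ∈ S | p ∣ A * t + B} : ℝ) = ∑ p ∈ S, c p t := by
    intro t
    simp [hc, sum_boole]
  have hfirst : ∀ p ∈ S, (X : ℝ) * (1 / p) - 1 ≤ ∑ t ∈ range X, c p t := by
    intro p hp
    have h := abs_card_dvd_linear_sub_le B X (hS p hp).1.pos (hS p hp).2
    have h2 : ∑ t ∈ range X, c p t = #{t ∈ range X | p ∣ A * t + B} := by simp [hc, sum_boole]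
    rw [h2]
    have := (abs_le.1 h).1
    rw [mul_one_div]
    linarith
  have hsecond : ∀ p ∈ S, ∀ q ∈ S, ∑ t ∈ range X, c p t * c q t ≤
      X * ((1 / p) * (1 / q)) + 1 + if p = q then X * (1 / p : ℝ) else 0 := by
    intro p hp q hq
    split_ifs with hpq
    · subst hpq
      have h := abs_card_dvd_linear_sub_le B X (hS p hp).1.pos (hS p hp).2
      have h2 : ∑ t ∈ range X, c p t * c p t = #{t ∈ range X | p ∣ A * t + B} := by
        rw [← sum_boole]
        refine sum_congr rfl fun t _ => ?_
        simp only [hc]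
        split_ifs <;> simp
      rw [h2]
      have := (abs_le.1 h).2
      have h3 : (0 : ℝ) ≤ X * ((1 / p) * (1 / p)) := by positivity
      have h4 : (X : ℝ) * (1 / p) = X / p := mul_one_div _ _
      rw [h4]
      linarith
    · have hcop : p.Coprime q := (Nat.coprime_primes (hS p hp).1 (hS q hq).1).2 hpq
      have h := abs_card_dvd_linear_sub_le B X (Nat.mul_pos (hS p hp).1.pos (hS q hq).1.pos)
        (Nat.Coprime.mul_right (hS p hp).2 (hS q hq).2)
      have h2 : ∑ t ∈ range X, c p t * c q t = #{t ∈ range X | p * q ∣ A * t + B} := by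
        rw [← sum_boole]
        refine sum_congr rfl fun t _ => ?_
        have hiff : p * q ∣ A * t + B ↔ p ∣ A * t + B ∧ q ∣ A * t + B :=
          ⟨fun h => ⟨dvd_of_mul_right_dvd h, dvd_of_mul_left_dvd h⟩,
            fun h => Nat.Coprime.mul_dvd_of_dvd_of_dvd hcop h.1 h.2⟩
        simp only [hc, hiff]
        by_cases h1 : p ∣ A * t + B <;> by_cases h2 : q ∣ A * t + B <;> simp [h1, h2]
      rw [h2]
      have := (abs_le.1 h).2
      push_cast at this
      have h4 : (X : ℝ) * (1 / p * (1 / q)) = X / (p * q) := by rw [one_div_mul_one_div, mul_one_div]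
      rw [h4]
      linarith
  have hexp : ∑ t ∈ range X, ((#{p ∈ S | p ∣ A * t + B} : ℝ) - μ) ^ 2 =
      ∑ p ∈ S, ∑ q ∈ S, ∑ t ∈ range X, c p t * c q t -
        2 * μ * ∑ p ∈ S, ∑ t ∈ range X, c p t + X * μ ^ 2 := by
    have h1 : ∑ p ∈ S, ∑ q ∈ S, ∑ t ∈ range X, c p t * c q t =
        ∑ t ∈ range X, (∑ p ∈ S, c p t) ^ 2 := by
      simp_rw [sq, sum_mul_sum]
      rw [sum_comm (s := range X)]
      refine sum_congr rfl fun p _ => ?_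
      rw [sum_comm]
    have h2 : ∑ p ∈ S, ∑ t ∈ range X, c p t = ∑ t ∈ range X, ∑ p ∈ S, c p t := sum_comm
    rw [h1, h2, mul_sum, ← sum_sub_distrib]
    have h3 : (X : ℝ) * μ ^ 2 = ∑ t ∈ range X, μ ^ 2 := by simp
    rw [h3, ← sum_add_distrib]
    refine sum_congr rfl fun t _ => ?_
    rw [hcard]
    ring
  have hA : ∑ p ∈ S, ∑ q ∈ S, ∑ t ∈ range X, c p t * c q t ≤ X * μ ^ 2 + (#S : ℝ) ^ 2 + X * μ := by
    calc _ ≤ ∑ p ∈ S, ∑ q ∈ S,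
          (X * ((1 / p) * (1 / q)) + 1 + if p = q then X * (1 / p : ℝ) else 0) :=
          sum_le_sum fun p hp => sum_le_sum fun q hq => hsecond p hp q hq
      _ = _ := by
          simp_rw [sum_add_distrib, ← mul_sum, ← sum_mul]
          rw [← hμ]
          have : ∑ p ∈ S, ∑ q ∈ S, (if p = q then (X : ℝ) * (1 / p) else 0) = X * μ := by
            rw [hμ, mul_sum]
            refine sum_congr rfl fun p hp => ?_
            rw [sum_ite_eq]
            simp [hp]
          rw [this]
          simp
          ring
  have hB : X * μ - #S ≤ ∑ p ∈ S, ∑ t ∈ range X, c p t := by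
    calc X * μ - #S = ∑ p ∈ S, ((X : ℝ) * (1 / p) - 1) := by
          rw [sum_sub_distrib, ← mul_sum]; simp [hμ]
      _ ≤ _ := sum_le_sum hfirst
  rw [hexp]
  have hS0 : (0 : ℝ) ≤ #S := by positivity
  nlinarith [mul_le_mul_of_nonneg_left hB hμ0, mul_le_mul_of_nonneg_right hμS hS0]

lemma sum_inv_sq_le (Z : ℕ) : ∑ n ∈ Ico 5 Z, (1 / n ^ 2 : ℝ) ≤ 1 / 4 := by
  rcases le_or_gt Z 5 with h | h
  · rw [Ico_eq_empty_of_le h]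
    norm_num
  · obtain ⟨k, rfl⟩ := Nat.exists_eq_add_of_le h.le
    have key : ∀ k : ℕ, ∑ n ∈ Ico 5 (5 + k), (1 / n ^ 2 : ℝ) ≤ 1 / 4 - 1 / (4 + k) := by
      intro k
      induction k with
      | zero => simp
      | succ k ih =>
        rw [← add_assoc, sum_Ico_succ_top (by omega)]
        have : (1 : ℝ) / ((5 + k : ℕ) : ℝ) ^ 2 ≤ 1 / (4 + k) - 1 / (4 + (k + 1 : ℕ)) := by
          push_cast
          rw [div_sub_div _ _ (by positivity) (by positivity),
            div_le_div_iff₀ (by positivity) (by positivity)]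
          nlinarith [(Nat.cast_nonneg k : (0 : ℝ) ≤ k)]
        linarith
    have := key k
    have h0 : (0 : ℝ) ≤ 1 / (4 + k) := by positivity
    linarith

lemma card_not_squarefree_le {A B X Z : ℕ} (h0 : ∀ t < X, A * t + B ≠ 0)
    (h5 : ∀ p t : ℕ, p.Prime → p ∣ A * t + B → 5 ≤ p ∧ A.Coprime p)
    (hZ : ∀ t < X, A * t + B < Z ^ 2) (hZX : 8 * Z ≤ X) :
    (#{t ∈ range X | ¬ Squarefree (A * t + B)} : ℝ) ≤ 3 / 8 * X := by
  have hsub : {t ∈ range X | ¬ Squarefree (A * t + B)} ⊆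
      {p ∈ Ico 5 Z | A.Coprime p}.biUnion fun p => {t ∈ range X | p ^ 2 ∣ A * t + B} := by
    intro t ht
    obtain ⟨htX, ht⟩ := mem_filter.1 ht
    have htX := mem_range.1 htX
    rw [Nat.squarefree_iff_prime_squarefree] at ht
    push Not at ht
    obtain ⟨p, hp, hpt⟩ := ht
    have hp5 := h5 p t hp (dvd_of_mul_left_dvd hpt)
    have hle := Nat.le_of_dvd (Nat.pos_of_ne_zero (h0 t htX)) hpt
    have hpZ : p < Z := by
      by_contra hcon
      have := hZ t htX
      have := Nat.mul_le_mul (not_lt.1 hcon) (not_lt.1 hcon)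
      nlinarith
    simp only [mem_biUnion, mem_filter, mem_Ico, mem_range]
    exact ⟨p, ⟨⟨hp5.1, hpZ⟩, hp5.2⟩, htX, by rwa [sq]⟩
  have hcard := (card_le_card hsub).trans card_biUnion_le
  have hterm : ∀ p ∈ {p ∈ Ico 5 Z | A.Coprime p},
      (#{t ∈ range X | p ^ 2 ∣ A * t + B} : ℝ) ≤ X * (1 / p ^ 2 : ℝ) + 1 := by
    intro p hp
    simp only [mem_filter, mem_Ico] at hp
    have := (abs_le.1 (abs_card_dvd_linear_sub_le (A := A) (D := p ^ 2) B X
      (by have := hp.1.1; positivity) (Nat.Coprime.pow_right 2 hp.2))).2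
    push_cast at this
    rw [mul_one_div]
    linarith
  calc (#{t ∈ range X | ¬ Squarefree (A * t + B)} : ℝ)
      ≤ ∑ p ∈ Ico 5 Z with A.Coprime p, (#{t ∈ range X | p ^ 2 ∣ A * t + B} : ℝ) := by
        exact_mod_cast hcard
    _ ≤ ∑ p ∈ Ico 5 Z with A.Coprime p, (X * (1 / p ^ 2 : ℝ) + 1) := sum_le_sum hterm
    _ ≤ ∑ p ∈ Ico 5 Z, (X * (1 / p ^ 2 : ℝ) + 1) :=
        sum_le_sum_of_subset_of_nonneg (filter_subset _ _) fun _ _ _ => by positivity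
    _ = X * ∑ p ∈ Ico 5 Z, (1 / p ^ 2 : ℝ) + (Z - 5 : ℕ) := by
        rw [sum_add_distrib, mul_sum]; simp
    _ ≤ X * (1 / 4) + Z := by
        gcongr
        · exact sum_inv_sq_le Z
        · omega
    _ ≤ _ := by
        have : (8 : ℝ) * Z ≤ X := by exact_mod_cast hZX
        linarith

lemma d_eq_two_pow_of_squarefree {n : ℕ} (hn : Squarefree n) : d n = 2 ^ #n.primeFactors := by
  rw [d, Nat.card_divisors hn.ne_zero, prod_congr rfl (g := fun _ => 2), prod_const]
  intro p hp
  have h1 := hn.natFactorization_le_one p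
  have h2 := (Nat.prime_of_mem_primeFactors hp).factorization_pos_of_dvd hn.ne_zero
    (Nat.dvd_of_mem_primeFactors hp)
  omega

lemma card_primeFactors_le_add_three {n y : ℕ} (hn : n ≠ 0) (h : n < y ^ 4) :
    #n.primeFactors ≤ #{p ∈ n.primeFactors | p ≤ y} + 3 := by
  have hy : 0 < y := Nat.pos_of_ne_zero fun h0 => by simp [h0] at h
  rw [← card_filter_add_card_filter_not (s := n.primeFactors) (p := fun p => p ≤ y)]
  have h1 : y ^ #{p ∈ n.primeFactors | ¬ p ≤ y} ≤ n := by
    calc y ^ #{p ∈ n.primeFactors | ¬ p ≤ y} ≤ ∏ p ∈ n.primeFactors with ¬ p ≤ y, p :=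
          pow_card_le_prod _ _ _ fun p hp => (not_le.1 (mem_filter.1 hp).2).le
      _ ≤ ∏ p ∈ n.primeFactors, p :=
          prod_le_prod_of_subset_of_one_le' (filter_subset _ _) fun p hp _ =>
            (Nat.prime_of_mem_primeFactors hp).one_le
      _ ≤ n := Nat.le_of_dvd (Nat.pos_of_ne_zero hn) (Nat.prod_primeFactors_dvd n)
  by_contra hcon
  have h2 : 4 ≤ #{p ∈ n.primeFactors | ¬ p ≤ y} := by omega
  have := Nat.pow_le_pow_right hy h2
  omega

/-- For at least half of all `t < X`, the value `A * t + B` is squarefree and its number of prime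
factors is within `R` (up to three extra large primes) of the expected value. -/
lemma card_not_typical_le {m R M A B y : ℕ} (hy : y = 2 ^ 2 ^ (m + 2))
    (h6 : 6 ∣ M) (hM0 : 0 < M) (hM : M ≤ 2 ^ 2 ^ m)
    (hA : A ∣ M) (hAp : ∀ p : ℕ, p.Prime → p ∣ M → p ∣ A) (hB : B.Coprime M) (hB0 : 0 < B)
    (hBM : B ≤ (2 ^ 2 ^ m) ^ 2) (hR : 32 * (m + 4) ≤ R ^ 2) :
    (#{t ∈ range (y ^ 2) | ¬ (Squarefree (A * t + B) ∧
      (∑ p ∈ Ioc (0 : ℕ) y with p.Prime ∧ ¬ p ∣ M, (1 / p : ℝ)) <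
        #(A * t + B).primeFactors + R ∧
      (#(A * t + B).primeFactors : ℝ) <
        ∑ p ∈ Ioc (0 : ℕ) y with p.Prime ∧ ¬ p ∣ M, (1 / p : ℝ) + R + 3)} : ℝ) ≤
      1 / 2 * (y ^ 2 : ℕ) := by
  set S := {p ∈ Ioc (0 : ℕ) y | p.Prime ∧ ¬ p ∣ M} with hS
  set μ := ∑ p ∈ S, (1 / p : ℝ) with hμ
  obtain ⟨H, hH⟩ : ∃ H, H = 2 ^ 2 ^ m := ⟨_, rfl⟩
  rw [← hH] at hM hBM
  have hH6 : 6 ≤ H := (Nat.le_of_dvd hM0 h6).trans hM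
  have hHy : H ^ 4 = y := by rw [hH, hy, ← pow_mul]; congr 1; ring
  have hy0 : 0 < y := by rw [hy]; positivity
  have h16 : 16 * H ≤ y := by
    rw [← hHy]
    have : 6 ^ 3 ≤ H ^ 3 := Nat.pow_le_pow_left hH6 3
    nlinarith
  have hA0 : 0 < A := Nat.pos_of_dvd_of_pos hA hM0
  have hAH : A ≤ H := (Nat.le_of_dvd hM0 hA).trans hM
  have hpos : ∀ t, A * t + B ≠ 0 := fun t => by omega
  have hdvd : ∀ p t : ℕ, p.Prime → p ∣ A * t + B → ¬ p ∣ M := by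
    intro p t hp h hpM
    have h1 : p ∣ B := (Nat.dvd_add_right ((hAp p hp hpM).mul_right t)).1 h
    exact hp.one_lt.ne' (Nat.dvd_one.1 (hB ▸ Nat.dvd_gcd h1 hpM))
  have hcop : ∀ p : ℕ, p.Prime → ¬ p ∣ M → A.Coprime p := fun p hp h =>
    ((Nat.Prime.coprime_iff_not_dvd hp).2 fun hpA => h (hpA.trans hA)).symm
  have hlt : ∀ t < y ^ 2, A * t + B < (2 * H * y) ^ 2 := by
    intro t ht
    have h1 : A * t ≤ H * y ^ 2 := Nat.mul_le_mul hAH ht.le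
    have h2 : H * y ^ 2 ≤ H ^ 2 * y ^ 2 := Nat.mul_le_mul_right _ (by nlinarith)
    have h3 : H ^ 2 ≤ H ^ 2 * y ^ 2 := Nat.le_mul_of_pos_right _ (by positivity)
    have h4 : 0 < H ^ 2 * y ^ 2 := by positivity
    have h5 : (2 * H * y) ^ 2 = 4 * (H ^ 2 * y ^ 2) := by ring
    omega
  have hlt4 : ∀ t < y ^ 2, A * t + B < y ^ 4 := by
    intro t ht
    refine (hlt t ht).trans_le ?_
    have : 2 * H * y ≤ y * y := Nat.mul_le_mul_right _ (by omega)
    calc (2 * H * y) ^ 2 ≤ (y * y) ^ 2 := Nat.pow_le_pow_left this 2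
      _ = y ^ 4 := by ring
  have hsq := card_not_squarefree_le (A := A) (B := B) (X := y ^ 2) (Z := 2 * H * y)
    (fun t _ => hpos t)
    (fun p t hp h => by
      have hpM := hdvd p t hp h
      refine ⟨?_, hcop p hp hpM⟩
      by_contra hcon
      have h2 := hp.two_le
      have : p = 2 ∨ p = 3 ∨ p = 4 := by omega
      rcases this with rfl | rfl | rfl
      · exact hpM (dvd_trans (by norm_num) h6)
      · exact hpM (dvd_trans (by norm_num) h6)
      · exact absurd hp (by norm_num))
    hlt (by nlinarith)
  have hSy : #S ≤ y := (card_le_card (filter_subset _ _)).trans (by simp)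
  have htk := sum_sq_card_dvd_sub_le (A := A) (B := B) (X := y ^ 2) (S := S)
    (fun p hp => ⟨(mem_filter.1 hp).2.1, hcop p (mem_filter.1 hp).2.1 (mem_filter.1 hp).2.2⟩)
    (Nat.pow_le_pow_left hSy 2)
  have hμle : μ ≤ 4 * (m + 2 : ℕ) + 5 := by
    refine le_trans ?_ (sum_primes_inv_le (m + 2))
    rw [← hy]
    refine sum_le_sum_of_subset_of_nonneg (fun p hp => ?_) fun _ _ _ => by positivity
    rw [hS, mem_filter] at hp
    exact mem_filter.2 ⟨hp.1, hp.2.1⟩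
  have hRμ : 8 * (μ + 3) ≤ (R : ℝ) ^ 2 := by
    have : (32 * (m + 4) : ℝ) ≤ (R : ℝ) ^ 2 := by exact_mod_cast hR
    push_cast at hμle
    linarith
  have hR0 : (0 : ℝ) < (R : ℝ) ^ 2 := by
    have : (32 * (m + 4) : ℝ) ≤ (R : ℝ) ^ 2 := by exact_mod_cast hR
    have h0 : (0 : ℝ) ≤ m := by positivity
    linarith
  set D := {t ∈ range (y ^ 2) | (R : ℝ) ^ 2 ≤ ((#{p ∈ S | p ∣ A * t + B} : ℝ) - μ) ^ 2} with hD
  have hmarkov : (#D : ℝ) ≤ 1 / 8 * (y ^ 2 : ℕ) := by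
    have h1 : (#D : ℝ) * (R : ℝ) ^ 2 ≤
        ∑ t ∈ range (y ^ 2), ((#{p ∈ S | p ∣ A * t + B} : ℝ) - μ) ^ 2 := by
      calc (#D : ℝ) * (R : ℝ) ^ 2 = #D • (R : ℝ) ^ 2 := (nsmul_eq_mul _ _).symm
        _ ≤ ∑ t ∈ D, ((#{p ∈ S | p ∣ A * t + B} : ℝ) - μ) ^ 2 :=
          card_nsmul_le_sum _ _ _ fun t ht => (mem_filter.1 ht).2
        _ ≤ _ := sum_le_sum_of_subset_of_nonneg (filter_subset _ _) fun _ _ _ => sq_nonneg _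
    have h2 := h1.trans htk
    have h3 : ((y ^ 2 : ℕ) : ℝ) * (8 * (μ + 3)) ≤ (y ^ 2 : ℕ) * (R : ℝ) ^ 2 :=
      mul_le_mul_of_nonneg_left hRμ (by positivity)
    refine le_of_mul_le_mul_right ?_ hR0
    linarith
  have hsub : {t ∈ range (y ^ 2) | ¬ (Squarefree (A * t + B) ∧
      μ < #(A * t + B).primeFactors + R ∧ (#(A * t + B).primeFactors : ℝ) < μ + R + 3)} ⊆
      {t ∈ range (y ^ 2) | ¬ Squarefree (A * t + B)} ∪ D := by
    intro t ht
    rw [mem_filter] at ht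
    rw [mem_union, mem_filter, hD, mem_filter]
    by_contra hcon
    push Not at hcon
    have hs := hcon.1 ht.1
    have hd := abs_lt_of_sq_lt_sq (hcon.2 ht.1) (by positivity)
    rw [abs_lt] at hd
    have hset : {p ∈ (A * t + B).primeFactors | p ≤ y} = {p ∈ S | p ∣ A * t + B} := by
      ext p
      simp only [hS, mem_filter, Nat.mem_primeFactors, mem_Ioc]
      constructor
      · rintro ⟨⟨hp, hpd, -⟩, hpy⟩
        exact ⟨⟨⟨hp.pos, hpy⟩, hp, hdvd p t hp hpd⟩, hpd⟩
      · rintro ⟨⟨⟨-, hpy⟩, hp, -⟩, hpd⟩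
        exact ⟨⟨hp, hpd, hpos t⟩, hpy⟩
    have h1 := card_primeFactors_le_add_three (hpos t) (hlt4 t (mem_range.1 ht.1))
    have h2 : #{p ∈ (A * t + B).primeFactors | p ≤ y} ≤ #(A * t + B).primeFactors :=
      card_le_card (filter_subset _ _)
    rw [hset] at h1 h2
    have h1' : (#(A * t + B).primeFactors : ℝ) ≤ #{p ∈ S | p ∣ A * t + B} + 3 := by
      exact_mod_cast h1
    have h2' : (#{p ∈ S | p ∣ A * t + B} : ℝ) ≤ #(A * t + B).primeFactors := by
      exact_mod_cast h2
    exact ht.2 ⟨hs, by linarith, by linarith⟩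
  have hcard : (#{t ∈ range (y ^ 2) | ¬ (Squarefree (A * t + B) ∧
      μ < #(A * t + B).primeFactors + R ∧ (#(A * t + B).primeFactors : ℝ) < μ + R + 3)} : ℝ) ≤
      #{t ∈ range (y ^ 2) | ¬ Squarefree (A * t + B)} + #D := by
    exact_mod_cast (card_le_card hsub).trans (card_union_le _ _)
  linarith

lemma exists_d_linear_eq {N m R M : ℕ} {A B : ℕ → ℕ}
    (h6 : 6 ∣ M) (hM0 : 0 < M) (hM : M ≤ 2 ^ 2 ^ m) (hA : ∀ i < N, A i ∣ M)
    (hAp : ∀ i < N, ∀ p : ℕ, p.Prime → p ∣ M → p ∣ A i) (hB : ∀ i < N, (B i).Coprime M)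
    (hB0 : ∀ i < N, 0 < B i) (hBM : ∀ i < N, B i ≤ (2 ^ 2 ^ m) ^ 2)
    (hR : 32 * (m + 4) ≤ R ^ 2) (hN : 4 * R + 10 < N) :
    ∃ t i j, i < j ∧ j < N ∧ d (A i * t + B i) = d (A j * t + B j) := by
  classical
  obtain ⟨y, hy⟩ : ∃ y, y = 2 ^ 2 ^ (m + 2) := ⟨_, rfl⟩
  have hy0 : 0 < y := by rw [hy]; positivity
  set μ := ∑ p ∈ Ioc (0 : ℕ) y with p.Prime ∧ ¬ p ∣ M, (1 / p : ℝ) with hμ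
  have hμ0 : 0 ≤ μ := sum_nonneg fun p _ => by positivity
  set good : ℕ → ℕ → Prop := fun i t => Squarefree (A i * t + B i) ∧
    μ < #(A i * t + B i).primeFactors + R ∧
      (#(A i * t + B i).primeFactors : ℝ) < μ + R + 3 with hgood
  have hbad : ∀ i ∈ range N, (#{t ∈ range (y ^ 2) | ¬ good i t} : ℝ) ≤ 1 / 2 * (y ^ 2 : ℕ) := by
    intro i hi
    have hi := mem_range.1 hi
    exact card_not_typical_le hy h6 hM0 hM (hA i hi) (hAp i hi) (hB i hi) (hB0 i hi) (hBM i hi) hR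
  have hsum : ∑ t ∈ range (y ^ 2), #{i ∈ range N | ¬ good i t} =
      ∑ i ∈ range N, #{t ∈ range (y ^ 2) | ¬ good i t} := by
    simp only [card_filter]
    exact sum_comm
  obtain ⟨t, -, ht⟩ : ∃ t ∈ range (y ^ 2),
      (#{i ∈ range N | ¬ good i t} : ℝ) ≤ 1 / 2 * N := by
    refine exists_le_of_sum_le (by simpa using hy0.ne') ?_
    calc ∑ t ∈ range (y ^ 2), (#{i ∈ range N | ¬ good i t} : ℝ)
        = ∑ i ∈ range N, (#{t ∈ range (y ^ 2) | ¬ good i t} : ℝ) := by exact_mod_cast hsum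
      _ ≤ ∑ i ∈ range N, 1 / 2 * ((y ^ 2 : ℕ) : ℝ) := sum_le_sum hbad
      _ = ∑ t ∈ range (y ^ 2), (1 / 2 * N : ℝ) := by simp; ring
  have hI : (N : ℝ) ≤ 2 * #{i ∈ range N | good i t} := by
    have := card_filter_add_card_filter_not (s := range N) (p := fun i => good i t)
    rw [card_range] at this
    have h' : (#{i ∈ range N | good i t} : ℝ) + #{i ∈ range N | ¬ good i t} = N := by
      exact_mod_cast this
    linarith
  have hI' : N ≤ 2 * #{i ∈ range N | good i t} := by exact_mod_cast hI
  obtain ⟨i, hi, j, hj, hij, heq⟩ := exists_ne_map_eq_of_card_lt_of_maps_to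
    (s := {i ∈ range N | good i t}) (t := Icc ⌊μ⌋₊ (⌊μ⌋₊ + 2 * R + 3))
    (f := fun i => #(A i * t + B i).primeFactors + R)
    (by rw [Nat.card_Icc]; omega)
    (by
      intro i hi
      obtain ⟨-, -, h1, h2⟩ := mem_filter.1 hi
      have h3 := Nat.floor_le hμ0
      have h4 := Nat.lt_floor_add_one μ
      rw [mem_coe, mem_Icc]
      constructor
      · have : (⌊μ⌋₊ : ℝ) < (#(A i * t + B i).primeFactors + R : ℕ) := by push_cast; linarith
        exact_mod_cast this.le
      · have : ((#(A i * t + B i).primeFactors + R : ℕ) : ℝ) < (⌊μ⌋₊ + 2 * R + 3 + 1 : ℕ) := by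
          push_cast; linarith
        have : #(A i * t + B i).primeFactors + R < ⌊μ⌋₊ + 2 * R + 3 + 1 := by exact_mod_cast this
        exact Nat.le_of_lt_succ this)
  obtain ⟨hiN, hi, -⟩ := mem_filter.1 hi
  obtain ⟨hjN, hj, -⟩ := mem_filter.1 hj
  have hd : d (A i * t + B i) = d (A j * t + B j) := by
    rw [d_eq_two_pow_of_squarefree hi, d_eq_two_pow_of_squarefree hj]
    congr 1
    simpa using heq
  rcases Nat.lt_or_gt_of_ne hij with h | h
  · exact ⟨t, i, j, h, mem_range.1 hjN, hd⟩
  · exact ⟨t, j, i, h, mem_range.1 hiN, hd.symm⟩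

lemma d_mul {a b : ℕ} (h : a.Coprime b) : d (a * b) = d a * d b :=
  h.card_divisors_mul

lemma d_pos {n : ℕ} (h : n ≠ 0) : 0 < d n :=
  card_pos.2 ⟨1, by simpa using h⟩

lemma d_prime_pow {p : ℕ} (hp : p.Prime) (k : ℕ) : d (p ^ k) = k + 1 := by
  rw [d, Nat.divisors_prime_pow hp, card_map, card_range]

lemma d_prod {ι : Type*} [DecidableEq ι] (s : Finset ι) (u : ι → ℕ)
    (h : ∀ i ∈ s, ∀ j ∈ s, i ≠ j → (u i).Coprime (u j)) :
    d (∏ i ∈ s, u i) = ∏ i ∈ s, d (u i) := by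
  induction s using Finset.induction_on with
  | empty => simp [d]
  | insert a s ha ih =>
    rw [prod_insert ha, prod_insert ha, d_mul, ih]
    · exact fun i hi j hj => h i (mem_insert_of_mem hi) j (mem_insert_of_mem hj)
    · exact Nat.Coprime.prod_right fun i hi => h a (mem_insert_self _ _) i (mem_insert_of_mem hi)
        fun hai => ha (hai ▸ hi)

/-- `n` is the product of `k` and a number coprime to `m`. -/
def ExactPart (n k m : ℕ) : Prop := ∃ w, n = k * w ∧ w.Coprime m

lemma ExactPart.mul {n k m k' m' : ℕ} (h : ExactPart n k m) (h' : ExactPart n k' m')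
    (hk : k.Coprime k') (hk' : 0 < k') : ExactPart n (k * k') (m * m') := by
  obtain ⟨w, rfl, hw⟩ := h
  obtain ⟨w', e, hw'⟩ := h'
  obtain ⟨z, rfl⟩ : k' ∣ w := hk.symm.dvd_of_dvd_mul_left ⟨w', e⟩
  refine ⟨z, by ring, Nat.Coprime.mul_right (Nat.Coprime.coprime_mul_left hw) ?_⟩
  have : w' = k * z := by
    refine Nat.eq_of_mul_eq_mul_left hk' ?_
    rw [← e]
    ring
  rw [this] at hw'
  exact Nat.Coprime.coprime_mul_left hw'

lemma ExactPart.prod {ι : Type*} [DecidableEq ι] {n : ℕ} (s : Finset ι) {k m : ι → ℕ}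
    (h : ∀ i ∈ s, ExactPart n (k i) (m i)) (hk : ∀ i ∈ s, 0 < k i)
    (hcop : ∀ i ∈ s, ∀ j ∈ s, i ≠ j → (k i).Coprime (k j)) :
    ExactPart n (∏ i ∈ s, k i) (∏ i ∈ s, m i) := by
  induction s using Finset.induction_on with
  | empty => exact ⟨n, by simp, by simp⟩
  | insert a s ha ih =>
    rw [prod_insert ha, prod_insert ha]
    refine (h a (mem_insert_self _ _)).mul
      (ih (fun i hi => h i (mem_insert_of_mem hi)) (fun i hi => hk i (mem_insert_of_mem hi))
        fun i hi j hj => hcop i (mem_insert_of_mem hi) j (mem_insert_of_mem hj)) ?_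
      (prod_pos fun i hi => hk i (mem_insert_of_mem hi))
    exact Nat.Coprime.prod_right fun i hi =>
      hcop a (mem_insert_self _ _) i (mem_insert_of_mem hi) fun hai => ha (hai ▸ hi)

lemma exactPart_of_modEq_prime_pow {p e v u a : ℕ} (hp : p.Prime) (hv : v < e)
    (hu : ¬ p ∣ u) (ha : a ≡ p ^ v * u [MOD p ^ e]) : ExactPart a (p ^ v) p := by
  have h1 : p ^ v ∣ a :=
    (ha.dvd_iff (pow_dvd_pow p hv.le)).2 (dvd_mul_right _ _)
  obtain ⟨w, rfl⟩ := h1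
  refine ⟨w, rfl, ((Nat.Prime.coprime_iff_not_dvd hp).2 fun hw => hu ?_).symm⟩
  have h2 : p ^ (v + 1) ∣ p ^ v * u := by
    rw [← ha.dvd_iff (pow_dvd_pow p hv), pow_succ]
    exact Nat.mul_dvd_mul_left _ hw
  rw [pow_succ] at h2
  exact Nat.dvd_of_mul_dvd_mul_left (pow_pos hp.pos v) h2

lemma exactPart_sub_of_modEq_prime_pow {p e v v' u u' a a' : ℕ} (hp : p.Prime) (hv : v < e)
    (hu : ¬ p ∣ u) (hu' : ¬ p ∣ u') (huu : v = v' → ¬ (p : ℤ) ∣ u' - u)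
    (ha : a ≡ p ^ v * u [MOD p ^ e]) (ha' : a' ≡ p ^ v' * u' [MOD p ^ e]) (hlt : a < a') :
    ExactPart (a' - a) (p ^ min v v') p := by
  have hpz : Prime (p : ℤ) := Nat.prime_iff_prime_int.1 hp
  obtain ⟨z, hz⟩ := (Nat.modEq_iff_dvd.1 ha)
  obtain ⟨z', hz'⟩ := (Nat.modEq_iff_dvd.1 ha')
  push_cast at hz hz'
  set k := min v v' with hk
  obtain ⟨x, hx⟩ : ∃ x, v = k + x := ⟨v - k, by omega⟩
  obtain ⟨x', hx'⟩ : ∃ x', v' = k + x' := ⟨v' - k, by omega⟩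
  obtain ⟨y, hy⟩ : ∃ y, e = k + (y + 1) := ⟨e - k - 1, by omega⟩
  have h1 : ((a' - a : ℕ) : ℤ) =
      p ^ k * ((p : ℤ) ^ x' * u' - p ^ x * u + p * (p ^ y * (z - z'))) := by
    rw [Nat.cast_sub hlt.le]
    have e1 : (a' : ℤ) - a = p ^ v' * u' - p ^ v * u + p ^ e * (z - z') := by linarith
    rw [e1, hx, hx', hy]
    ring
  have h2 : p ^ k ∣ a' - a := by
    have : ((p ^ k : ℕ) : ℤ) ∣ ((a' - a : ℕ) : ℤ) := ⟨_, by rw [h1]; push_cast; rfl⟩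
    exact_mod_cast this
  obtain ⟨w, hw⟩ := h2
  refine ⟨w, hw, ((Nat.Prime.coprime_iff_not_dvd hp).2 fun hpw => ?_).symm⟩
  have h3 : (w : ℤ) = (p : ℤ) ^ x' * u' - p ^ x * u + p * (p ^ y * (z - z')) := by
    rw [hw] at h1
    push_cast at h1
    exact mul_left_cancel₀ (pow_ne_zero _ hpz.ne_zero) h1
  have h4 : (p : ℤ) ∣ (p : ℤ) ^ x' * u' - p ^ x * u := by
    have h5 : (p : ℤ) ∣ w := by exact_mod_cast hpw
    rw [h3] at h5
    exact (Int.dvd_add_left (dvd_mul_right _ _)).1 h5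
  rcases Nat.eq_zero_or_pos x with h0 | h0
  · rcases Nat.eq_zero_or_pos x' with h0' | h0'
    · subst h0 h0'
      simp only [pow_zero, one_mul] at h4
      exact huu (by omega) h4
    · have h5 : (p : ℤ) ∣ (p : ℤ) ^ x' * u' := (dvd_pow_self _ h0'.ne').mul_right _
      have h6 := (dvd_sub_right h5).1 h4
      rw [h0, pow_zero, one_mul] at h6
      exact hu (by exact_mod_cast h6)
  · have h5 : (p : ℤ) ∣ (p : ℤ) ^ x * u := (dvd_pow_self _ h0.ne').mul_right _
    have h6 := (dvd_sub_left h5).1 h4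
    have h7 : x' = 0 := by omega
    rw [h7, pow_zero, one_mul] at h6
    exact hu' (by exact_mod_cast h6)

lemma nth_prime_le_two_pow (n : ℕ) : Nat.nth Nat.Prime n ≤ 2 ^ (n + 1) := by
  induction n with
  | zero => simp [Nat.nth_prime_zero_eq_two]
  | succ n ih =>
    obtain ⟨q, hq, h1, h2⟩ := Nat.exists_prime_lt_and_le_two_mul (Nat.nth Nat.Prime n)
      (Nat.prime_nth_prime n).ne_zero
    have h3 : Nat.nth Nat.Prime (n + 1) ≤ q := by
      rw [← Nat.nth_count hq] at h1 ⊢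
      exact (Nat.nth_le_nth Nat.infinite_setOfPred_prime).2
        ((Nat.nth_lt_nth Nat.infinite_setOfPred_prime).1 h1)
    rw [pow_succ]
    omega

lemma ExactPart.pow {n k m : ℕ} (h : ExactPart n k m) (e : ℕ) : ExactPart n k (m ^ e) := by
  obtain ⟨w, hw, hc⟩ := h
  exact ⟨w, hw, Nat.Coprime.pow_right e hc⟩

/-- Residues modulo a product `Q` of powers of small primes for which the `Q`-parts `V i` of
numbers in the residue classes, and the `Q`-parts of their differences, are prescribed. -/
lemma HasDesign.exists_residues {g : ℚ} (h : HasDesign g) :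
    ∃ b c : ℕ, ∀ N : ℕ, ∃ (Q : ℕ) (r V : ℕ → ℕ), 0 < Q ∧ (∀ p ≤ N, p.Prime → p ∣ Q) ∧
      Q ≤ 2 ^ ((b * N) ^ 2 * (c + N + 1)) ∧ (∀ i, ∀ p : ℕ, p.Prime → p ∣ Q → p * V i ∣ Q) ∧
      (∀ i < N, ∀ a, a ≡ r i [MOD Q] → ExactPart a (V i) Q) ∧
      ∀ i j, i < j → j < N → ∃ D, D ∣ V i ∧ D ∣ V j ∧
        (d (V j / D) : ℚ) = g * d (V i / D) ∧
        ∀ a a', a ≡ r i [MOD Q] → a' ≡ r j [MOD Q] → a < a' → ExactPart (a' - a) D Q := by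
  obtain ⟨b, c, hb, h⟩ := h.exists_injective_prefix
  refine ⟨b, c, fun N => ?_⟩
  obtain ⟨v, hvle, hinj, hprod⟩ := h N
  set T := b * N with hT
  have hNT : 2 * N ≤ T := Nat.mul_le_mul_right _ hb
  set e := c + N + 1 with he
  set P : ℕ → ℕ := fun s => Nat.nth Nat.Prime s with hP
  have hPp : ∀ s, (P s).Prime := Nat.prime_nth_prime
  have hve : ∀ s i, v s i < e := fun s i => by have := hvle s i; omega
  have hPne : ∀ s ∈ range T, ∀ s' ∈ range T, s ≠ s' → (P s).Coprime (P s') := by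
    intro s _ s' _ hs
    exact (Nat.coprime_primes (hPp s) (hPp s')).2 fun heq =>
      hs (Nat.nth_injective Nat.infinite_setOfPred_prime heq)
  have hPpow : ∀ w : ℕ → ℕ, ∀ s ∈ range T, ∀ s' ∈ range T, s ≠ s' →
      (P s ^ w s).Coprime (P s' ^ w s') :=
    fun w s hs s' hs' hne => Nat.Coprime.pow _ _ (hPne s hs s' hs' hne)
  have hpow0 : ∀ w : ℕ → ℕ, ∀ s ∈ range T, 0 < P s ^ w s := fun w s _ => pow_pos (hPp s).pos _
  set Q := (∏ s ∈ range T, P s) ^ e with hQ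
  set u : ℕ → ℕ → ℕ := fun s i => if s < 2 * N then 1 else i + 1 with hu
  have hr : ∀ i, ∃ x, ∀ s ∈ range T, x ≡ P s ^ v s i * u s i [MOD P s ^ e] := by
    intro i
    obtain ⟨x, hx⟩ := Nat.chineseRemainderOfFinset (fun s => P s ^ v s i * u s i)
      (fun s => P s ^ e) (range T) (fun s _ => (pow_pos (hPp s).pos _).ne')
      (fun s hs s' hs' hne => hPpow (fun _ => e) s hs s' hs' hne)
    exact ⟨x, hx⟩
  choose r hr using hr
  have hmod : ∀ i a, a ≡ r i [MOD Q] → ∀ s ∈ range T,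
      a ≡ P s ^ v s i * u s i [MOD P s ^ e] := by
    intro i a ha s hs
    exact (ha.of_dvd (pow_dvd_pow_of_dvd (dvd_prod_of_mem P hs) e)).trans (hr i s hs)
  have hui : ∀ s, ∀ i < N, ¬ P s ∣ u s i := by
    intro s i hi hdvd
    by_cases hs : s < 2 * N
    · simp only [hu, hs, if_true] at hdvd
      exact (hPp s).one_lt.ne' (Nat.dvd_one.1 hdvd)
    · simp only [hu, hs, if_false] at hdvd
      have h1 := Nat.le_of_dvd (Nat.succ_pos i) hdvd
      have h2 : s + 2 ≤ P s := Nat.add_two_le_nth_prime s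
      omega
  refine ⟨Q, r, fun i => ∏ s ∈ range T, P s ^ v s i, pow_pos (prod_pos fun s _ => (hPp s).pos) _,
    fun p hpN hp => ?_, ?_, fun i p hp hpQ => ?_, fun i hi a ha => ?_, fun i j hij hj => ?_⟩
  · have h1 : P (Nat.count Nat.Prime p) = p := Nat.nth_count hp
    have h2 : Nat.count Nat.Prime p + 2 ≤ p := by
      have := Nat.add_two_le_nth_prime (Nat.count Nat.Prime p)
      rwa [Nat.nth_count hp] at this
    rw [← h1]
    exact dvd_pow (dvd_prod_of_mem P (mem_range.2 (by omega))) (by omega)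
  · have h1 : ∏ s ∈ range T, P s ≤ (2 ^ T) ^ T := by
      have := prod_le_pow_card (range T) P (2 ^ T) fun s hs =>
        (nth_prime_le_two_pow s).trans (Nat.pow_le_pow_right (by norm_num) (mem_range.1 hs))
      rwa [card_range] at this
    calc Q ≤ ((2 ^ T) ^ T) ^ e := Nat.pow_le_pow_left h1 e
      _ = 2 ^ (T ^ 2 * e) := by rw [← pow_mul, ← pow_mul, sq, ← mul_assoc T T e]
  · have h1 := (Prime.dvd_finsetProd_iff hp.prime P).1 (hp.dvd_of_dvd_pow hpQ)
    obtain ⟨s, hs, hps⟩ := h1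
    calc p * ∏ s ∈ range T, P s ^ v s i
        ∣ (∏ s ∈ range T, P s) * ∏ s ∈ range T, P s ^ v s i :=
          mul_dvd_mul_right (hps.trans (dvd_prod_of_mem P hs)) _
      _ = ∏ s ∈ range T, P s ^ (v s i + 1) := by
          rw [← prod_mul_distrib]
          exact prod_congr rfl fun s _ => (pow_succ' _ _).symm
      _ ∣ ∏ s ∈ range T, P s ^ e := prod_dvd_prod_of_dvd _ _ fun s _ => pow_dvd_pow _ (hve s i)
      _ = Q := by rw [hQ, prod_pow]
  · exact (ExactPart.prod _ (fun s hs => exactPart_of_modEq_prime_pow (hPp s) (hve s i)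
      (hui s i hi) (hmod i a ha s hs)) (hpow0 _) (hPpow fun s => v s i)).pow e
  · have hdiv : ∀ w w' : ℕ → ℕ, (∀ s, w' s ≤ w s) →
        (∏ s ∈ range T, P s ^ w s) / ∏ s ∈ range T, P s ^ w' s =
          ∏ s ∈ range T, P s ^ (w s - w' s) := by
      intro w w' hw
      refine Nat.div_eq_of_eq_mul_left (prod_pos (hpow0 _)) ?_
      rw [← prod_mul_distrib]
      refine prod_congr rfl fun s _ => ?_
      rw [← pow_add, Nat.sub_add_cancel (hw s)]
    have hd : ∀ w : ℕ → ℕ, d (∏ s ∈ range T, P s ^ w s) = ∏ s ∈ range T, (w s + 1) := by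
      intro w
      rw [d_prod _ _ (hPpow w)]
      exact prod_congr rfl fun s _ => d_prime_pow (hPp s) _
    refine ⟨∏ s ∈ range T, P s ^ min (v s i) (v s j),
      prod_dvd_prod_of_dvd _ _ fun s _ => pow_dvd_pow _ (min_le_left _ _),
      prod_dvd_prod_of_dvd _ _ fun s _ => pow_dvd_pow _ (min_le_right _ _), ?_,
      fun a a' ha ha' hlt => ?_⟩
    · rw [hdiv _ _ fun s => min_le_left _ _, hdiv _ _ fun s => min_le_right _ _, hd, hd,
        ← hprod i j hij hj]
      push_cast
      rw [← prod_mul_distrib]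
      refine prod_congr rfl fun s _ => ?_
      have h1 : v s j - min (v s i) (v s j) = v s j - v s i := by omega
      have h2 : v s i - min (v s i) (v s j) = v s i - v s j := by omega
      rw [valRatio, h1, h2]
      push_cast
      field_simp
    · refine (ExactPart.prod _ (fun s hs => exactPart_sub_of_modEq_prime_pow (hPp s) (hve s i)
        (hui s i (hij.trans hj)) (hui s j hj) (fun hvv hdvd => ?_) (hmod i a ha s hs)
        (hmod j a' ha' s hs) hlt) (hpow0 _) (hPpow fun s => min (v s i) (v s j))).pow e
      by_cases hs' : s < 2 * N
      · exact hij.ne (hinj s hs' i (hij.trans hj) j hj hvv)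
      · simp only [hu, hs', if_false] at hdvd
        have h1 : P s ∣ j - i := by
          have h3 : ((j + 1 : ℕ) : ℤ) - (i + 1 : ℕ) = ((j - i : ℕ) : ℤ) := by omega
          rw [h3] at hdvd
          exact_mod_cast hdvd
        have h2 := Nat.le_of_dvd (by omega) h1
        have h3 : s + 2 ≤ P s := Nat.add_two_le_nth_prime s
        omega

/-- The pairs `(i, j)` with `i < j < N`. -/
def pairsBelow (N : ℕ) : Finset (ℕ × ℕ) := {x ∈ range N ×ˢ range N | x.1 < x.2}

lemma mem_pairsBelow {N : ℕ} {x : ℕ × ℕ} : x ∈ pairsBelow N ↔ x.1 < x.2 ∧ x.2 < N := by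
  simp only [pairsBelow, mem_filter, mem_product, mem_range]
  omega

lemma card_pairsBelow_le (N : ℕ) : #(pairsBelow N) ≤ N ^ 2 :=
  (card_filter_le _ _).trans (by simp [sq])

lemma exists_not_modEq {k q : ℕ} (hkq : k < q) (a : ℕ → ℕ) :
    ∃ c, ∀ i < k, ¬ c ≡ a i [MOD q] := by
  have h1 : #((range k).image fun i => a i % q) < #(range q) :=
    card_image_le.trans_lt (by simpa using hkq)
  obtain ⟨c, hc, hcn⟩ := exists_mem_notMem_of_card_lt_card h1
  refine ⟨c, fun i hi h => hcn (mem_image.2 ⟨i, mem_range.2 hi, ?_⟩)⟩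
  rw [← h, Nat.mod_eq_of_lt (mem_range.1 hc)]

lemma exists_spread_succ {k Q L : ℕ} {a : ℕ → ℕ} (ρ : ℕ) (hQ : 0 < Q) (hQL : Q ≤ L) (hL : 2 ≤ L)
    (hk : ∀ p ≤ k, p.Prime → p ∣ Q) (hmono : ∀ i j, i < j → j < k → a i < a j)
    (hlt : ∀ i < k, a i < L) :
    ∃ A, A ≡ ρ [MOD Q] ∧ (∀ i < k, a i < A) ∧ A < L ^ (k ^ 2 + 3) ∧
      (∀ q : ℕ, q.Prime → ¬ q ∣ Q → ∀ i < k, ∀ j < k, i < j → q ∣ a j - a i →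
        ∀ l < k, ¬ q ∣ A - a l) := by
  classical
  set Δ := ∏ x ∈ pairsBelow k, (a x.2 - a x.1) with hΔ
  have hΔ0 : Δ ≠ 0 := prod_ne_zero_iff.2 fun x hx => by
    obtain ⟨h1, h2⟩ := mem_pairsBelow.1 hx
    have := hmono _ _ h1 h2
    omega
  set S := {q ∈ Δ.primeFactors | ¬ q ∣ Q} with hS
  have hSp : ∀ q ∈ S, q.Prime := fun q hq => Nat.prime_of_mem_primeFactors (mem_filter.1 hq).1
  have hSΔ : ∏ q ∈ S, q ≤ L ^ k ^ 2 := by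
    calc ∏ q ∈ S, q ≤ ∏ q ∈ Δ.primeFactors, q :=
          prod_le_prod_of_subset_of_one_le' (filter_subset _ _) fun p hp _ =>
            (Nat.prime_of_mem_primeFactors hp).one_le
      _ ≤ Δ := Nat.le_of_dvd (Nat.pos_of_ne_zero hΔ0) (Nat.prod_primeFactors_dvd _)
      _ ≤ L ^ #(pairsBelow k) := prod_le_pow_card _ _ _ fun x hx =>
          (Nat.sub_le _ _).trans (hlt _ (mem_pairsBelow.1 hx).2).le
      _ ≤ L ^ k ^ 2 := Nat.pow_le_pow_right (by omega) (card_pairsBelow_le k)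
  have hc : ∀ q ∈ S, ∃ c, ∀ i < k, ¬ c ≡ a i [MOD q] := fun q hq =>
    exists_not_modEq (by
      by_contra hcon
      exact (mem_filter.1 hq).2 (hk q (not_lt.1 hcon) (hSp q hq))) a
  choose! c hc using hc
  obtain ⟨x, hx⟩ := Nat.chineseRemainderOfFinset c id S (fun q hq => (hSp q hq).ne_zero)
    (fun q hq q' hq' hne => (Nat.coprime_primes (hSp q hq) (hSp q' hq')).2 hne)
  have hQS : Q.Coprime (∏ q ∈ S, q) := Nat.Coprime.prod_right fun q hq =>
    ((Nat.Prime.coprime_iff_not_dvd (hSp q hq)).2 (mem_filter.1 hq).2).symm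
  have hS0 : 0 < ∏ q ∈ S, q := prod_pos fun q hq => (hSp q hq).pos
  obtain ⟨y, hy1, hy2⟩ := Nat.chineseRemainder hQS ρ x
  set m := Q * ∏ q ∈ S, q with hm
  have hm0 : 0 < m := Nat.mul_pos hQ hS0
  have hbig : ∀ i < k, a i < y % m + m * L := fun i hi => by
    have := hlt i hi
    have : 1 * L ≤ m * L := Nat.mul_le_mul_right L hm0
    omega
  have hmodm : y % m + m * L ≡ y [MOD m] := by
    rw [Nat.ModEq, Nat.add_mul_mod_self_left, Nat.mod_mod]
  refine ⟨y % m + m * L, (hmodm.of_dvd (dvd_mul_right _ _)).trans hy1, hbig, ?_, ?_⟩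
  · have h1 : y % m < m := Nat.mod_lt _ hm0
    have h2 : m ≤ L * L ^ k ^ 2 := Nat.mul_le_mul hQL hSΔ
    calc y % m + m * L < m + m * L := Nat.add_lt_add_right h1 _
      _ = m * (L + 1) := by ring
      _ ≤ (L * L ^ k ^ 2) * L ^ 2 := Nat.mul_le_mul h2 (by nlinarith)
      _ = L ^ (k ^ 2 + 3) := by ring
  · intro q hq hqQ i hi j hj hij hdvd l hl hdl
    have hqS : q ∈ S := mem_filter.2 ⟨Nat.mem_primeFactors.2 ⟨hq,
      hdvd.trans (dvd_prod_of_mem (fun x : ℕ × ℕ => a x.2 - a x.1)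
        (mem_pairsBelow.2 ⟨hij, hj⟩ : (i, j) ∈ pairsBelow k)), hΔ0⟩, hqQ⟩
    have h1 : a l ≡ y % m + m * L [MOD q] := (Nat.modEq_iff_dvd' (hbig l hl).le).2 hdl
    have h2 : y % m + m * L ≡ y [MOD q] :=
      hmodm.of_dvd ((dvd_prod_of_mem (fun q : ℕ => q) hqS).mul_left _)
    have h3 : y ≡ x [MOD q] := hy2.of_dvd (dvd_prod_of_mem (fun q : ℕ => q) hqS)
    exact hc q hqS l hl (((h1.trans h2).trans h3).trans (hx q hqS)).symm

/-- Numbers in prescribed residue classes modulo `Q` such that every prime not dividing `Q`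
divides at most one of their differences. -/
lemma exists_spread {N Q L : ℕ} (r : ℕ → ℕ) (hQ : 0 < Q) (hQL : Q ≤ L) (hL : 2 ≤ L)
    (hN : ∀ p ≤ N, p.Prime → p ∣ Q) (k : ℕ) (hk : k ≤ N) :
    ∃ a : ℕ → ℕ, (∀ i < k, a i ≡ r i [MOD Q]) ∧ (∀ i j, i < j → j < k → a i < a j) ∧
      (∀ i < k, a i < L ^ (N ^ 2 + 3) ^ k) ∧
      ∀ q : ℕ, q.Prime → ¬ q ∣ Q → ∀ i j i' j', i < j → j < k → i' < j' → j' < k →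
        q ∣ a j - a i → q ∣ a j' - a i' → i = i' ∧ j = j' := by
  induction k with
  | zero => exact ⟨id, by simp, by simp, by simp, fun _ _ _ _ j _ _ _ hj => by simp at hj⟩
  | succ k ih =>
    obtain ⟨a, hmod, hmono, hlt, hq⟩ := ih (by omega)
    have hexp : 1 ≤ (N ^ 2 + 3) ^ k := Nat.one_le_pow _ _ (by omega)
    have hLL : L ≤ L ^ (N ^ 2 + 3) ^ k := Nat.le_self_pow (by omega) L
    obtain ⟨A, hA1, hA2, hA3, hA4⟩ := exists_spread_succ (r k) hQ (hQL.trans hLL) (hL.trans hLL)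
      (fun p hp => hN p (by omega)) hmono hlt
    have hA3' : A < L ^ (N ^ 2 + 3) ^ (k + 1) := by
      refine hA3.trans_le ?_
      rw [← pow_mul, pow_succ]
      refine Nat.pow_le_pow_right (by omega) (Nat.mul_le_mul_left _ ?_)
      exact Nat.add_le_add_right (Nat.pow_le_pow_left (by omega) 2) 3
    set a' : ℕ → ℕ := fun i => if i < k then a i else A with ha'
    have ha'lt : ∀ i, i < k → a' i = a i := fun i hi => by simp [ha', hi]
    have ha'k : a' k = A := by simp [ha']
    have hcase : ∀ i, i < k + 1 → i < k ∨ i = k := fun i hi => by omega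
    have hsame : ∀ q : ℕ, q.Prime → ¬ q ∣ Q → ∀ i < k, ∀ i' < k, i < i' →
        q ∣ A - a i → ¬ q ∣ A - a i' := by
      intro q hqp hqQ i hi i' hi' hii hd hd'
      refine hA4 q hqp hqQ i hi i' hi' hii ?_ i hi hd
      have h1 := hA2 i hi
      have h2 := hA2 i' hi'
      have h3 : a i' - a i = (A - a i) - (A - a i') := by
        have := hmono i i' hii hi'
        omega
      rw [h3]
      exact Nat.dvd_sub hd hd'
    refine ⟨a', fun i hi => ?_, fun i j hij hj => ?_, fun i hi => ?_, ?_⟩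
    · rcases hcase i hi with h | rfl
      · rw [ha'lt i h]
        exact hmod i h
      · rw [ha'k]
        exact hA1
    · rw [ha'lt i (by omega)]
      rcases hcase j hj with h | rfl
      · rw [ha'lt j h]
        exact hmono i j hij h
      · rw [ha'k]
        exact hA2 i hij
    · rcases hcase i hi with h | rfl
      · rw [ha'lt i h]
        exact (hlt i h).trans_le (Nat.pow_le_pow_right (by omega)
          (Nat.pow_le_pow_right (by omega) (Nat.le_succ k)))
      · rw [ha'k]
        exact hA3'
    · intro q hqp hqQ i j i' j' hij hj hij' hj' hd hd'
      rw [ha'lt i (by omega)] at hd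
      rw [ha'lt i' (by omega)] at hd'
      rcases hcase j hj with h | rfl <;> rcases hcase j' hj' with h' | rfl
      · rw [ha'lt j h] at hd
        rw [ha'lt j' h'] at hd'
        exact hq q hqp hqQ i j i' j' hij h hij' h' hd hd'
      · rw [ha'lt j h] at hd
        rw [ha'k] at hd'
        exact absurd hd' (hA4 q hqp hqQ i (by omega) j h hij hd i' hij')
      · rw [ha'k] at hd
        rw [ha'lt j' h'] at hd'
        exact absurd hd (hA4 q hqp hqQ i' (by omega) j' h' hij' hd' i hij)
      · rw [ha'k] at hd hd'
        refine ⟨?_, rfl⟩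
        rcases lt_trichotomy i i' with h | h | h
        · exact absurd hd' (hsame q hqp hqQ i hij i' hij' h hd)
        · exact h
        · exact absurd hd (hsame q hqp hqQ i' hij' i hij h hd')

/-- A number with prescribed number of divisors, built from prescribed primes. -/
lemma exists_d_eq_of_primes {Y β : ℕ} (hY : Y ≠ 0) (σ : ℕ → ℕ) (hσ : StrictMono σ)
    (hp : ∀ n, (σ n).Prime) (hβ : ∀ n, 2 ^ n ≤ Y → σ n ≤ 2 ^ β) :
    ∃ Z, 0 < Z ∧ d Z = d Y ∧ Z ≤ Y ^ β ∧ ∀ q : ℕ, q.Prime → q ∣ Z → ∃ n, q = σ n := by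
  set idx : ℕ → ℕ := fun p => #{q ∈ Y.primeFactors | q < p} with hidx
  have hmono : ∀ p ∈ Y.primeFactors, ∀ p' ∈ Y.primeFactors, p < p' → idx p < idx p' := by
    intro p hpm p' _ hlt
    refine card_lt_card (ssubset_iff_of_subset (fun q hq => ?_) |>.2 ⟨p, ?_, ?_⟩)
    · exact mem_filter.2 ⟨(mem_filter.1 hq).1, (mem_filter.1 hq).2.trans hlt⟩
    · exact mem_filter.2 ⟨hpm, hlt⟩
    · simp
  have hfac : ∏ p ∈ Y.primeFactors, p ^ Y.factorization p = Y := Nat.prod_factorization_pow_eq_self hY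
  have hbound : ∀ p, σ (idx p) ≤ 2 ^ β := by
    intro p
    refine hβ _ ?_
    calc 2 ^ idx p ≤ ∏ q ∈ Y.primeFactors with q < p, q := pow_card_le_prod _ _ _ fun q hq =>
          (Nat.prime_of_mem_primeFactors (mem_filter.1 hq).1).two_le
      _ ≤ ∏ q ∈ Y.primeFactors, q :=
          prod_le_prod_of_subset_of_one_le' (filter_subset _ _) fun q hq _ =>
            (Nat.prime_of_mem_primeFactors hq).one_le
      _ ≤ Y := Nat.le_of_dvd (Nat.pos_of_ne_zero hY) (Nat.prod_primeFactors_dvd _)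
  refine ⟨∏ p ∈ Y.primeFactors, σ (idx p) ^ Y.factorization p,
    prod_pos fun p _ => pow_pos (hp _).pos _, ?_, ?_, ?_⟩
  · rw [d_prod, d, Nat.card_divisors hY]
    · exact prod_congr rfl fun p _ => d_prime_pow (hp _) _
    · intro p hpm p' hpm' hne
      refine Nat.Coprime.pow _ _ ((Nat.coprime_primes (hp _) (hp _)).2 fun heq => ?_)
      have heq := hσ.injective heq
      rcases Nat.lt_or_gt_of_ne hne with h | h
      · exact (hmono p hpm p' hpm' h).ne heq
      · exact (hmono p' hpm' p hpm h).ne' heq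
  · calc ∏ p ∈ Y.primeFactors, σ (idx p) ^ Y.factorization p
        ≤ ∏ p ∈ Y.primeFactors, (p ^ Y.factorization p) ^ β := by
          refine prod_le_prod' fun p hpm => ?_
          calc σ (idx p) ^ Y.factorization p ≤ (2 ^ β) ^ Y.factorization p :=
                Nat.pow_le_pow_left (hbound p) _
            _ ≤ (p ^ β) ^ Y.factorization p := Nat.pow_le_pow_left
                (Nat.pow_le_pow_left (Nat.prime_of_mem_primeFactors hpm).two_le _) _
            _ = (p ^ Y.factorization p) ^ β := by rw [← pow_mul, ← pow_mul, mul_comm]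
      _ = Y ^ β := by rw [prod_pow, hfac]
  · intro q hq hqZ
    obtain ⟨p, -, h⟩ := (Prime.dvd_finsetProd_iff hq.prime _).1 hqZ
    exact ⟨idx p, (Nat.prime_dvd_prime_iff_eq hq (hp _)).1 (hq.dvd_of_dvd_pow h)⟩

/-- Pairwise coprime numbers with large prime factors and prescribed numbers of divisors. -/
lemma exists_coprime_d_eq {N l κ : ℕ} {Y : ℕ → ℕ} (hY : ∀ i < N, Y i ≠ 0)
    (hYle : ∀ i < N, Y i ≤ 2 ^ κ) :
    ∃ Z : ℕ → ℕ, (∀ i < N, 0 < Z i ∧ d (Z i) = d (Y i) ∧ Z i ≤ 2 ^ (κ * (l + N * (κ + 1) + 1)) ∧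
      ∀ q : ℕ, q.Prime → q ∣ Z i → 2 ^ l < q) ∧
      ∀ i < N, ∀ j < N, i ≠ j → (Z i).Coprime (Z j) := by
  have hπ : ∀ n, ∃ p : ℕ, p.Prime ∧ 2 ^ (l + n) < p ∧ p ≤ 2 ^ (l + n + 1) := by
    intro n
    obtain ⟨p, hp, h1, h2⟩ := Nat.exists_prime_lt_and_le_two_mul (2 ^ (l + n)) (by positivity)
    exact ⟨p, hp, h1, by rwa [pow_succ, mul_comm]⟩
  choose π hπp hπ1 hπ2 using hπ
  have hπm : StrictMono π := strictMono_nat_of_lt_succ fun n => (hπ2 n).trans_lt (hπ1 (n + 1))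
  have hZ : ∀ i, ∃ Z, i < N → 0 < Z ∧ d Z = d (Y i) ∧ Z ≤ Y i ^ (l + N * (κ + 1) + 1) ∧
      ∀ q : ℕ, q.Prime → q ∣ Z → ∃ n, q = π (N * n + i) := by
    intro i
    by_cases hi : i < N
    · have hβ : ∀ n, 2 ^ n ≤ Y i → π (N * n + i) ≤ 2 ^ (l + N * (κ + 1) + 1) := by
        intro n hn
        refine (hπ2 _).trans (Nat.pow_le_pow_right (by norm_num) ?_)
        have h1 : n ≤ κ := (Nat.pow_le_pow_iff_right (by norm_num)).1 (hn.trans (hYle i hi))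
        have h2 : N * n ≤ N * κ := Nat.mul_le_mul_left N h1
        have h3 : N * (κ + 1) = N * κ + N := by ring
        omega
      obtain ⟨Z, hZ⟩ := exists_d_eq_of_primes (hY i hi) (fun n => π (N * n + i))
        (fun n n' h => hπm (Nat.add_lt_add_right (Nat.mul_lt_mul_of_pos_left h (by omega)) i))
        (fun n => hπp _) hβ
      exact ⟨Z, fun _ => hZ⟩
    · exact ⟨0, fun h => absurd h hi⟩
  choose Z hZ using hZ
  refine ⟨Z, fun i hi => ⟨(hZ i hi).1, (hZ i hi).2.1, ?_, fun q hq hqZ => ?_⟩,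
    fun i hi j hj hij => ?_⟩
  · rw [pow_mul]
    exact (hZ i hi).2.2.1.trans (Nat.pow_le_pow_left (hYle i hi) _)
  · obtain ⟨n, rfl⟩ := (hZ i hi).2.2.2 q hq hqZ
    exact (Nat.pow_le_pow_right (by norm_num) (Nat.le_add_right _ _)).trans_lt (hπ1 _)
  · refine Nat.coprime_of_dvd fun q hq h1 h2 => hij ?_
    obtain ⟨n, hn⟩ := (hZ i hi).2.2.2 q hq h1
    obtain ⟨n', hn'⟩ := (hZ j hj).2.2.2 q hq h2
    have h := hπm.injective (hn.symm.trans hn')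
    have h3 := congrArg (· % N) h
    simpa [Nat.mul_add_mod, Nat.mod_eq_of_lt hi, Nat.mod_eq_of_lt hj] using h3

lemma exists_add_modEq (a b : ℕ) {m : ℕ} (hm : 0 < m) : ∃ c, c + a ≡ b [MOD m] := by
  refine ⟨b + a * (m - 1), ?_⟩
  have h : b + a * (m - 1) + a = b + m * a := by
    obtain ⟨k, rfl⟩ : ∃ k, m = k + 1 := ⟨m - 1, by omega⟩
    simp only [Nat.add_sub_cancel]
    ring
  rw [h, Nat.ModEq, Nat.add_mul_mod_self_left]

lemma exists_forall_add_modEq {ι : Type*} [DecidableEq ι] (s : Finset ι) (a b m : ι → ℕ)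
    (hm : ∀ i ∈ s, 0 < m i) (hcop : ∀ i ∈ s, ∀ j ∈ s, i ≠ j → (m i).Coprime (m j)) :
    ∃ n, ∀ i ∈ s, n + a i ≡ b i [MOD m i] := by
  have h : ∀ i ∈ s, ∃ c, c + a i ≡ b i [MOD m i] := fun i hi => exists_add_modEq _ _ (hm i hi)
  choose! c hc using h
  obtain ⟨n, hn⟩ := Nat.chineseRemainderOfFinset c m s (fun i hi => (hm i hi).ne')
    (fun i hi j hj hij => hcop i hi j hj hij)
  exact ⟨n, fun i hi => ((hn i hi).add_right _).trans (hc i hi)⟩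

lemma exactPart_of_modEq_mul_self {n c k : ℕ} (hk : 0 < k) (hc : c.Coprime k)
    (h : n ≡ c * k [MOD k ^ 2]) : ExactPart n k k := by
  have h1 : k ∣ n := (h.dvd_iff (dvd_pow_self k two_ne_zero)).2 (dvd_mul_left _ _)
  obtain ⟨w, rfl⟩ := h1
  refine ⟨w, rfl, ?_⟩
  have h2 : w ≡ c [MOD k] := by
    rw [sq, mul_comm c k] at h
    exact Nat.ModEq.mul_left_cancel' hk.ne' h
  rw [Nat.Coprime, h2.gcd_eq]
  exact hc

lemma exactPart_one {n m : ℕ} (h : n.Coprime m) : ExactPart n 1 m := ⟨n, (one_mul n).symm, h⟩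

lemma coprime_of_large_primes {l z m : ℕ} (hz : ∀ q : ℕ, q.Prime → q ∣ z → 2 ^ l < q)
    (hm0 : 0 < m) (hm : m ≤ 2 ^ l) : z.Coprime m :=
  Nat.coprime_of_dvd fun q hq h1 h2 => by
    have := hz q hq h1
    have := Nat.le_of_dvd hm0 h2
    omega

/-- A family of linear forms `A i * t + B i` such that, after multiplication by suitable constants
with prescribed numbers of divisors, any two of them take consecutive values. -/
structure LinearConfig (g : ℚ) (N M : ℕ) (A B K : ℕ → ℕ) : Prop where
  mul_eq : ∀ i < N, K i * A i = M
  dvd_of_dvd : ∀ i < N, ∀ p : ℕ, p.Prime → p ∣ M → p ∣ A i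
  coprime : ∀ i < N, (B i).Coprime M
  le : ∀ i < N, N ≤ B i
  consecutive : ∀ i j, i < j → j < N → ∃ Δ, Δ ∣ K i ∧ Δ ∣ K j ∧ K j * B j = K i * B i + Δ ∧
    (d (K j / Δ) : ℚ) = g * d (K i / Δ)

lemma exists_linearConfig {g : ℚ} {N Q l : ℕ} {r V a : ℕ → ℕ} (hQ0 : 0 < Q) (h2 : 2 ∣ Q)
    (hQl : Q ≤ 2 ^ l) (hVQ : ∀ i, ∀ p : ℕ, p.Prime → p ∣ Q → p * V i ∣ Q)
    (hV : ∀ i < N, ∀ a, a ≡ r i [MOD Q] → ExactPart a (V i) Q)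
    (hD : ∀ i j, i < j → j < N → ∃ D, D ∣ V i ∧ D ∣ V j ∧
        (d (V j / D) : ℚ) = g * d (V i / D) ∧
        ∀ a a', a ≡ r i [MOD Q] → a' ≡ r j [MOD Q] → a < a' → ExactPart (a' - a) D Q)
    (hmod : ∀ i < N, a i ≡ r i [MOD Q]) (hmono : ∀ i j, i < j → j < N → a i < a j)
    (hlt : ∀ i < N, a i < 2 ^ l)
    (huniq : ∀ q : ℕ, q.Prime → ¬ q ∣ Q → ∀ i j i' j', i < j → j < N → i' < j' → j' < N →
        q ∣ a j - a i → q ∣ a j' - a i' → i = i' ∧ j = j') :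
    ∃ M A B K, LinearConfig g N M A B K ∧ Q ∣ M ∧ 0 < M ∧
      M ≤ 2 ^ (l + 2 * (l * N ^ 2) +
        2 * (N * (l * N ^ 2 * (l + N * (l * N ^ 2 + 1) + 1)))) ∧
      ∀ i < N, B i ≤ M * (N + 1) + 2 ^ l := by
  classical
  have hVdvd : ∀ i, V i ∣ Q := fun i => dvd_of_mul_left_dvd (hVQ i 2 Nat.prime_two h2)
  have hV0 : ∀ i, 0 < V i := fun i => Nat.pos_of_dvd_of_pos (hVdvd i) hQ0
  have hDE : ∀ x ∈ pairsBelow N, ∃ D E, D ∣ V x.1 ∧ D ∣ V x.2 ∧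
      (d (V x.2 / D) : ℚ) = g * d (V x.1 / D) ∧ a x.2 - a x.1 = D * E ∧ E.Coprime Q := by
    intro x hx
    obtain ⟨h1, h2⟩ := mem_pairsBelow.1 hx
    obtain ⟨D, hD1, hD2, hD3, hD4⟩ := hD _ _ h1 h2
    obtain ⟨E, hE⟩ := hD4 _ _ (hmod _ (h1.trans h2)) (hmod _ h2) (hmono _ _ h1 h2)
    exact ⟨D, E, hD1, hD2, hD3, hE⟩
  choose! D E hD1 hD2 hD3 hDE hEQ using hDE
  have hsub0 : ∀ x ∈ pairsBelow N, 0 < a x.2 - a x.1 := fun x hx =>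
    Nat.sub_pos_of_lt (hmono _ _ (mem_pairsBelow.1 hx).1 (mem_pairsBelow.1 hx).2)
  have hE0 : ∀ x ∈ pairsBelow N, 0 < E x := fun x hx => Nat.pos_of_ne_zero fun h => by
    have := hsub0 x hx
    rw [hDE x hx, h] at this
    simp at this
  have hEl : ∀ x ∈ pairsBelow N, E x ≤ 2 ^ l := fun x hx => by
    have h1 := Nat.le_of_dvd (hsub0 x hx) ⟨D x, (hDE x hx).trans (mul_comm _ _)⟩
    have h2 := hlt x.2 (mem_pairsBelow.1 hx).2
    omega
  have hEdvd : ∀ x ∈ pairsBelow N, E x ∣ a x.2 - a x.1 := fun x hx =>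
    ⟨D x, (hDE x hx).trans (mul_comm _ _)⟩
  have hEnot : ∀ x ∈ pairsBelow N, ∀ q : ℕ, q.Prime → q ∣ E x → ¬ q ∣ Q := fun x hx q hq h1 h2 =>
    hq.one_lt.ne' (Nat.dvd_one.1 (hEQ x hx ▸ Nat.dvd_gcd h1 h2))
  have hDEcop : ∀ x ∈ pairsBelow N, (D x).Coprime (E x) := fun x hx =>
    (Nat.Coprime.coprime_dvd_right ((hD1 x hx).trans (hVdvd _)) (hEQ x hx)).symm
  have hEcop : ∀ x ∈ pairsBelow N, ∀ y ∈ pairsBelow N, x ≠ y → (E x).Coprime (E y) := by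
    intro x hx y hy hxy
    refine Nat.coprime_of_dvd fun q hq h1 h2 => hxy ?_
    obtain ⟨hx1, hx2⟩ := mem_pairsBelow.1 hx
    obtain ⟨hy1, hy2⟩ := mem_pairsBelow.1 hy
    have := huniq q hq (hEnot x hx q hq h1) _ _ _ _ hx1 hx2 hy1 hy2
      (h1.trans (hEdvd x hx)) (h2.trans (hEdvd y hy))
    exact Prod.ext this.1 this.2
  set P := ∏ x ∈ pairsBelow N, E x with hP
  set U : ℕ → ℕ := fun i => ∏ x ∈ pairsBelow N with x.1 = i ∨ x.2 = i, E x with hU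
  set Y : ℕ → ℕ := fun i => ∏ x ∈ pairsBelow N with ¬ (x.1 = i ∨ x.2 = i), E x with hY
  have hUY : ∀ i, U i * Y i = P := fun i => prod_filter_mul_prod_filter_not _ _ _
  have hUYcop : ∀ i, (U i).Coprime (Y i) := fun i =>
    Nat.Coprime.prod_left fun x hx => Nat.Coprime.prod_right fun y hy =>
      hEcop x (mem_filter.1 hx).1 y (mem_filter.1 hy).1 fun hxy =>
        (mem_filter.1 hy).2 (hxy ▸ (mem_filter.1 hx).2)
  have hP0 : 0 < P := prod_pos hE0
  have hPQ : P.Coprime Q := Nat.Coprime.prod_left hEQ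
  have hPle : P ≤ 2 ^ (l * N ^ 2) := by
    rw [pow_mul]
    exact (prod_le_pow_card _ _ _ hEl).trans
      (Nat.pow_le_pow_right (by positivity) (card_pairsBelow_le N))
  have hY0 : ∀ i, Y i ≠ 0 := fun i => (Nat.pos_of_mul_pos_left (hUY i ▸ hP0)).ne'
  have hYle : ∀ i, Y i ≤ 2 ^ (l * N ^ 2) := fun i =>
    (Nat.le_of_dvd hP0 ⟨U i, (hUY i).symm.trans (mul_comm _ _)⟩).trans hPle
  obtain ⟨Z, hZ, hZcop⟩ := exists_coprime_d_eq (l := l) (fun i (_ : i < N) => hY0 i)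
    fun i _ => hYle i
  have hZQ : ∀ i < N, (Z i).Coprime Q := fun i hi =>
    coprime_of_large_primes (hZ i hi).2.2.2 hQ0 hQl
  have hZE : ∀ i < N, ∀ x ∈ pairsBelow N, (Z i).Coprime (E x) := fun i hi x hx =>
    coprime_of_large_primes (hZ i hi).2.2.2 (hE0 x hx) (hEl x hx)
  set S := ∏ i ∈ range N, Z i with hS
  have hS0 : 0 < S := prod_pos fun i hi => (hZ i (mem_range.1 hi)).1
  have hSQ : S.Coprime Q := Nat.Coprime.prod_left fun i hi => hZQ i (mem_range.1 hi)
  have hSP : S.Coprime P := Nat.Coprime.prod_left fun i hi =>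
    Nat.Coprime.prod_right fun x hx => hZE i (mem_range.1 hi) x hx
  set M := Q * (P ^ 2 * S ^ 2) with hM
  have hM0 : 0 < M := by positivity
  obtain ⟨n, hnN, hnM, hnQ, hnE, hnZ⟩ : ∃ n, M * N ≤ n ∧ n < M * (N + 1) ∧ n ≡ 0 [MOD Q] ∧
      (∀ x ∈ pairsBelow N, n + a x.1 ≡ D x * E x [MOD E x ^ 2]) ∧
      ∀ i ∈ range N, n + a i ≡ Z i [MOD Z i ^ 2] := by
    obtain ⟨n₁, hn₁⟩ := exists_forall_add_modEq (pairsBelow N) (fun x => a x.1)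
      (fun x => D x * E x) (fun x => E x ^ 2) (fun x hx => pow_pos (hE0 x hx) 2)
      fun x hx y hy hxy => Nat.Coprime.pow 2 2 (hEcop x hx y hy hxy)
    obtain ⟨n₂, hn₂⟩ := exists_forall_add_modEq (range N) a Z (fun i => Z i ^ 2)
      (fun i hi => pow_pos (hZ i (mem_range.1 hi)).1 2)
      fun i hi j hj hij => Nat.Coprime.pow 2 2
        (hZcop i (mem_range.1 hi) j (mem_range.1 hj) hij)
    obtain ⟨n₃, hn₃, hn₃'⟩ := Nat.chineseRemainder (Nat.Coprime.pow 2 2 hSP.symm) n₁ n₂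
    obtain ⟨n₄, hn₄, hn₄'⟩ := Nat.chineseRemainder
      (Nat.Coprime.mul_right (Nat.Coprime.pow_right 2 hPQ.symm) (Nat.Coprime.pow_right 2 hSQ.symm))
      0 n₃
    have hmodM : n₄ % M + M * N ≡ n₄ [MOD M] := by
      rw [Nat.ModEq, Nat.add_mul_mod_self_left, Nat.mod_mod]
    have hlast : n₄ % M + M * N ≡ n₃ [MOD P ^ 2 * S ^ 2] :=
      (hmodM.of_dvd (dvd_mul_left _ _)).trans hn₄'
    refine ⟨n₄ % M + M * N, Nat.le_add_left _ _, ?_, (hmodM.of_dvd (dvd_mul_right _ _)).trans hn₄,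
      fun x hx => ?_, fun i hi => ?_⟩
    · have := Nat.mod_lt n₄ hM0
      rw [Nat.mul_succ]
      omega
    · have h1 : E x ^ 2 ∣ P ^ 2 := pow_dvd_pow_of_dvd (dvd_prod_of_mem E hx) 2
      exact ((((hlast.of_dvd (dvd_mul_right _ _)).trans hn₃).of_dvd h1).add_right _).trans
        (hn₁ x hx)
    · have h1 : Z i ^ 2 ∣ S ^ 2 := pow_dvd_pow_of_dvd (dvd_prod_of_mem Z hi) 2
      exact ((((hlast.of_dvd (dvd_mul_left _ _)).trans hn₃').of_dvd h1).add_right _).trans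
        (hn₂ i hi)
  have hdiff : ∀ i < N, ∀ j < N, i ≠ j → ∀ q : ℕ, q ∣ n + a i → q ∣ n + a j →
      ∃ i' j', (i' = i ∧ j' = j ∨ i' = j ∧ j' = i) ∧ i' < j' ∧ j' < N ∧ q ∣ a j' - a i' := by
    intro i hi j hj hij q h1 h2
    rcases Nat.lt_or_gt_of_ne hij with h | h
    · refine ⟨i, j, Or.inl ⟨rfl, rfl⟩, h, hj, ?_⟩
      have := Nat.dvd_sub h2 h1
      rwa [Nat.add_sub_add_left] at this
    · refine ⟨j, i, Or.inr ⟨rfl, rfl⟩, h, hi, ?_⟩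
      have := Nat.dvd_sub h1 h2
      rwa [Nat.add_sub_add_left] at this
  have hexE : ∀ i < N, ∀ x ∈ pairsBelow N,
      ExactPart (n + a i) (if x.1 = i ∨ x.2 = i then E x else 1) (E x) := by
    intro i hi x hx
    obtain ⟨hx1, hx2⟩ := mem_pairsBelow.1 hx
    by_cases hinc : x.1 = i ∨ x.2 = i
    · rw [if_pos hinc]
      by_cases hxi : x.1 = i
      · have := hnE x hx
        rw [hxi] at this
        exact exactPart_of_modEq_mul_self (hE0 x hx) (hDEcop x hx) this
      · have hxi2 : x.2 = i := hinc.resolve_left hxi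
        have h1 := (hnE x hx).add_right (a x.2 - a x.1)
        rw [add_assoc, Nat.add_sub_cancel' (hmono _ _ hx1 hx2).le, hxi2] at h1
        have h3 : D x * E x + (a i - a x.1) = (2 * D x) * E x := by
          rw [← hxi2, hDE x hx]
          ring
        rw [h3] at h1
        refine exactPart_of_modEq_mul_self (hE0 x hx) (Nat.Coprime.mul_left ?_ (hDEcop x hx)) h1
        exact (Nat.Coprime.coprime_dvd_right h2 (hEQ x hx)).symm
    · rw [if_neg hinc]
      push Not at hinc
      refine exactPart_one (Nat.coprime_of_dvd fun q hq h1 h3 => ?_)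
      have h4 : q ∣ n + a x.1 :=
        ((hnE x hx).dvd_iff (h3.trans (dvd_pow_self _ two_ne_zero))).2 (h3.mul_left _)
      obtain ⟨i', j', hij', h5, h6, h7⟩ := hdiff i hi x.1 (hx1.trans hx2) hinc.1.symm q h1 h4
      have h8 := huniq q hq (hEnot x hx q hq h3) _ _ _ _ h5 h6 hx1 hx2 h7
        (h3.trans (hEdvd x hx))
      rcases hij' with ⟨rfl, rfl⟩ | ⟨rfl, rfl⟩
      · exact hinc.1 h8.1.symm
      · exact hinc.2 h8.2.symm
  have hexZ : ∀ i < N, ∀ j ∈ range N,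
      ExactPart (n + a i) (if i = j then Z j else 1) (Z j) := by
    intro i hi j hj
    have hjN := mem_range.1 hj
    by_cases hij : i = j
    · subst hij
      rw [if_pos rfl]
      exact exactPart_of_modEq_mul_self (hZ i hi).1 (Nat.coprime_one_left _)
        (by rw [one_mul]; exact hnZ i hj)
    · rw [if_neg hij]
      refine exactPart_one (Nat.coprime_of_dvd fun q hq h1 h3 => ?_)
      have h4 : q ∣ n + a j :=
        ((hnZ j hj).dvd_iff (h3.trans (dvd_pow_self _ two_ne_zero))).2 h3
      obtain ⟨i', j', -, h5, h6, h7⟩ := hdiff i hi j hjN hij q h1 h4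
      have h8 := Nat.le_of_dvd (Nat.sub_pos_of_lt (hmono _ _ h5 h6)) h7
      have h9 := hlt j' h6
      have h10 := (hZ j hjN).2.2.2 q hq h3
      omega
  have hUQ : ∀ i, (U i).Coprime Q := fun i => Nat.Coprime.coprime_dvd_left ⟨Y i, (hUY i).symm⟩ hPQ
  have hUZ : ∀ i, ∀ j < N, (U i).Coprime (Z j) := fun i j hj =>
    Nat.Coprime.prod_left fun x hx => (hZE j hj x (mem_filter.1 hx).1).symm
  have hexact : ∀ i < N, ExactPart (n + a i) (V i * (U i * Z i)) (Q * (P * S)) := by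
    intro i hi
    have e1 : ExactPart (n + a i) (V i) Q := by
      refine hV i hi _ ?_
      have := hnQ.add (hmod i hi)
      rwa [zero_add] at this
    have e2 : ExactPart (n + a i) (U i) P := by
      have := ExactPart.prod (pairsBelow N) (hexE i hi)
        (fun x hx => by split_ifs; exacts [hE0 x hx, one_pos])
        (fun x hx y hy hxy => by
          split_ifs <;> first
            | exact hEcop x hx y hy hxy
            | exact Nat.coprime_one_right _
            | exact Nat.coprime_one_left _)
      rwa [← prod_filter] at this
    have e3 : ExactPart (n + a i) (Z i) S := by
      have := ExactPart.prod (range N) (hexZ i hi)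
        (fun j hj => by split_ifs; exacts [(hZ j (mem_range.1 hj)).1, one_pos])
        (fun j hj k hk hjk => by
          split_ifs <;> first
            | exact hZcop j (mem_range.1 hj) k (mem_range.1 hk) hjk
            | exact Nat.coprime_one_right _
            | exact Nat.coprime_one_left _)
      rwa [prod_ite_eq, if_pos (mem_range.2 hi)] at this
    refine e1.mul (e2.mul e3 (hUZ i i hi) (hZ i hi).1) ?_
      (Nat.mul_pos (Nat.pos_of_mul_pos_right (hUY i ▸ hP0)) (hZ i hi).1)
    exact (Nat.Coprime.coprime_dvd_right (hVdvd i)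
      (Nat.Coprime.mul_left (hUQ i) (hZQ i hi))).symm
  choose! B hB hBcop using hexact
  have hKdvd : ∀ i < N, V i * (U i * Z i) *
      (Q / V i * (P * Y i * (S * ∏ j ∈ (range N).erase i, Z j))) = M := by
    intro i hi
    have h3 : Z i * ∏ j ∈ (range N).erase i, Z j = S := mul_prod_erase _ _ (mem_range.2 hi)
    have h4 : V i * (Q / V i) = Q := Nat.mul_div_cancel' (hVdvd i)
    calc _ = (V i * (Q / V i)) * (P * (U i * Y i) *
          (S * (Z i * ∏ j ∈ (range N).erase i, Z j))) := by ring
      _ = M := by rw [h3, h4, hUY, hM]; ring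
  have hU : ∀ x ∈ pairsBelow N, ∀ i < N, (x.1 = i ∨ x.2 = i) → ∃ u, U i = E x * u ∧
      u.Coprime Q ∧ u.Coprime (Z i) ∧ d (E x) * (d u * d (Z i)) = d P := by
    intro x hx i hi hxi
    have h3 : E x * ∏ y ∈ {x ∈ pairsBelow N | x.1 = i ∨ x.2 = i}.erase x, E y = U i :=
      mul_prod_erase _ _ (mem_filter.2 ⟨hx, hxi⟩)
    refine ⟨_, h3.symm, Nat.Coprime.coprime_dvd_left ⟨E x, h3.symm.trans (mul_comm _ _)⟩ (hUQ i),
      Nat.Coprime.coprime_dvd_left ⟨E x, h3.symm.trans (mul_comm _ _)⟩ (hUZ i i hi), ?_⟩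
    rw [(hZ i hi).2.1, ← mul_assoc, ← d_mul, h3, ← d_mul (hUYcop i), hUY]
    refine Nat.Coprime.prod_right fun y hy => ?_
    obtain ⟨hy1, hy2⟩ := mem_erase.1 hy
    exact hEcop x hx y (mem_filter.1 hy2).1 hy1.symm
  have hdK : ∀ x ∈ pairsBelow N, ∀ i < N, (x.1 = i ∨ x.2 = i) → D x ∣ V i →
      D x * E x ∣ V i * (U i * Z i) ∧
        d (E x) * d (V i * (U i * Z i) / (D x * E x)) = d (V i / D x) * d P := by
    intro x hx i hi hxi hDV
    obtain ⟨u, hu1, hu2, hu3, hu4⟩ := hU x hx i hi hxi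
    have hD0 : 0 < D x := Nat.pos_of_dvd_of_pos hDV (hV0 i)
    have h3 : V i * (U i * Z i) = D x * E x * (V i / D x * (u * Z i)) := by
      calc V i * (U i * Z i) = (D x * (V i / D x)) * (E x * u * Z i) := by
            rw [Nat.mul_div_cancel' hDV, hu1]
        _ = _ := by ring
    refine ⟨⟨_, h3⟩, ?_⟩
    rw [h3, Nat.mul_div_cancel_left _ (Nat.mul_pos hD0 (hE0 x hx)), d_mul, d_mul hu3, ← hu4]
    · ring
    · exact (Nat.Coprime.coprime_dvd_right ((Nat.div_dvd_of_dvd hDV).trans (hVdvd i))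
        (Nat.Coprime.mul_left hu2 (hZQ i hi))).symm
  have hBle : ∀ i < N, B i ≤ n + a i := fun i hi => by
    have hK0 : 0 < V i * (U i * Z i) := Nat.pos_of_mul_pos_right ((hKdvd i hi).symm ▸ hM0)
    rw [hB i hi]
    exact Nat.le_mul_of_pos_left _ hK0
  refine ⟨M, fun i => Q / V i * (P * Y i * (S * ∏ j ∈ (range N).erase i, Z j)), B,
    fun i => V i * (U i * Z i), ⟨hKdvd, fun i hi p hp hpM => ?_, fun i hi => ?_, fun i hi => ?_,
      fun i j hij hj => ?_⟩, dvd_mul_right _ _, hM0, ?_, fun i hi => ?_⟩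
  · rcases (Nat.Prime.dvd_mul hp).1 hpM with h | h
    · refine Dvd.dvd.mul_right ?_ _
      have h3 := hVQ i p hp h
      exact (Nat.dvd_div_iff_mul_dvd (hVdvd i)).2 (by rwa [mul_comm])
    · refine Dvd.dvd.mul_left ?_ _
      rcases (Nat.Prime.dvd_mul hp).1 h with h | h
      · exact ((hp.dvd_of_dvd_pow h).mul_right _).mul_right _
      · exact ((hp.dvd_of_dvd_pow h).mul_right _).mul_left _
  · have h3 := hBcop i hi
    have h4 : (B i).Coprime Q := Nat.Coprime.coprime_mul_right_right h3
    have h5 := Nat.Coprime.coprime_mul_left_right h3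
    exact Nat.Coprime.mul_right h4 (Nat.Coprime.mul_right
      (Nat.Coprime.pow_right 2 (Nat.Coprime.coprime_mul_right_right h5))
      (Nat.Coprime.pow_right 2 (Nat.Coprime.coprime_mul_left_right h5)))
  · have hK0 : 0 < V i * (U i * Z i) := Nat.pos_of_mul_pos_right ((hKdvd i hi).symm ▸ hM0)
    refine Nat.le_of_mul_le_mul_left ?_ hK0
    calc V i * (U i * Z i) * N ≤ M * N :=
          Nat.mul_le_mul_right _ (Nat.le_of_dvd hM0 ⟨_, (hKdvd i hi).symm⟩)
      _ ≤ n + a i := hnN.trans (Nat.le_add_right _ _)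
      _ = _ := hB i hi
  · have hx : (i, j) ∈ pairsBelow N := mem_pairsBelow.2 ⟨hij, hj⟩
    have hi := hij.trans hj
    obtain ⟨hdi, hdi'⟩ := hdK (i, j) hx i hi (Or.inl rfl) (hD1 _ hx)
    obtain ⟨hdj, hdj'⟩ := hdK (i, j) hx j hj (Or.inr rfl) (hD2 _ hx)
    refine ⟨_, hdi, hdj, ?_, ?_⟩
    · rw [← hB i hi, ← hB j hj, ← hDE _ hx, add_assoc, Nat.add_sub_cancel' (hmono i j hij hj).le]
    · have hE : (d (E (i, j)) : ℚ) ≠ 0 := by exact_mod_cast (d_pos (hE0 _ hx).ne').ne'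
      have h3 := hD3 _ hx
      refine mul_left_cancel₀ hE ?_
      have hi' : (d (E (i, j)) : ℚ) * d (V i * (U i * Z i) / (D (i, j) * E (i, j))) =
        d (V i / D (i, j)) * d P := by exact_mod_cast hdi'
      have hj' : (d (E (i, j)) : ℚ) * d (V j * (U j * Z j) / (D (i, j) * E (i, j))) =
        d (V j / D (i, j)) * d P := by exact_mod_cast hdj'
      rw [hj', h3, mul_left_comm, hi', mul_assoc]
  · have hSle : S ≤ 2 ^ (N * (l * N ^ 2 * (l + N * (l * N ^ 2 + 1) + 1))) := by
      rw [mul_comm N, pow_mul]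
      have := prod_le_pow_card (range N) Z _ fun i hi => (hZ i (mem_range.1 hi)).2.2.1
      rwa [card_range] at this
    calc M ≤ 2 ^ l * ((2 ^ (l * N ^ 2)) ^ 2 *
          (2 ^ (N * (l * N ^ 2 * (l + N * (l * N ^ 2 + 1) + 1)))) ^ 2) :=
          Nat.mul_le_mul hQl
            (Nat.mul_le_mul (Nat.pow_le_pow_left hPle 2) (Nat.pow_le_pow_left hSle 2))
      _ = _ := by
          rw [← pow_mul, ← pow_mul, ← pow_add, ← pow_add]
          congr 1
          ring
  · have := hBle i hi
    have := hlt i hi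
    omega

lemma LinearConfig.exists_div_eq {g : ℚ} {N M t i j : ℕ} {A B K : ℕ → ℕ}
    (h : LinearConfig g N M A B K) (hM : 0 < M) (hij : i < j) (hj : j < N)
    (hd : d (A i * t + B i) = d (A j * t + B j)) (hB : 0 < B i) :
    ∃ n, N ≤ n ∧ (d (n + 1) : ℚ) / d n = g := by
  have hi := hij.trans hj
  obtain ⟨Δ, ⟨u, hu⟩, ⟨v, hv⟩, h3, h4⟩ := h.consecutive i j hij hj
  have hKi : 0 < K i := Nat.pos_of_mul_pos_right ((h.mul_eq i hi).symm ▸ hM)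
  have hΔ : 0 < Δ := Nat.pos_of_mul_pos_right (hu ▸ hKi)
  have hu0 : 0 < u := Nat.pos_of_mul_pos_left (hu ▸ hKi)
  have hcop : ∀ k < N, ∀ w, w ∣ K k → w.Coprime (A k * t + B k) := fun k hk w hw =>
    Nat.coprime_of_dvd fun q hq h5 h6 => by
      have h7 : q ∣ M := (h5.trans hw).trans ⟨_, (h.mul_eq k hk).symm⟩
      have h8 : q ∣ B k := (Nat.dvd_add_right ((h.dvd_of_dvd k hk q hq h7).mul_right t)).1 h6
      exact Nat.not_coprime_of_dvd_of_dvd hq.one_lt h8 h7 (h.coprime k hk)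
  have hn : v * (A j * t + B j) = u * (A i * t + B i) + 1 := by
    refine Nat.eq_of_mul_eq_mul_left hΔ ?_
    calc Δ * (v * (A j * t + B j)) = K j * A j * t + K j * B j := by rw [hv]; ring
      _ = K i * A i * t + (K i * B i + Δ) := by rw [h.mul_eq j hj, h.mul_eq i hi, h3]
      _ = Δ * (u * (A i * t + B i) + 1) := by rw [hu]; ring
  rw [hu, hv, Nat.mul_div_cancel_left _ hΔ, Nat.mul_div_cancel_left _ hΔ] at h4
  refine ⟨u * (A i * t + B i), (h.le i hi).trans ?_, ?_⟩
  · exact (Nat.le_add_left _ _).trans (Nat.le_mul_of_pos_left _ hu0)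
  · rw [← hn, d_mul (hcop j hj v ⟨Δ, by rw [hv, mul_comm]⟩),
      d_mul (hcop i hi u ⟨Δ, by rw [hu, mul_comm]⟩), ← hd]
    have h5 : (d u : ℚ) ≠ 0 := by exact_mod_cast (d_pos hu0.ne').ne'
    have h6 : (d (A i * t + B i) : ℚ) ≠ 0 := by exact_mod_cast (d_pos (by omega)).ne'
    push_cast
    rw [h4]
    field_simp

lemma config_exponent_le {l N : ℕ} (hl : 2 ≤ l) (hN : N ≤ l) :
    l + 2 * (l * N ^ 2) + 2 * (N * (l * N ^ 2 * (l + N * (l * N ^ 2 + 1) + 1))) ≤ l ^ 12 := by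
  have h1 : ∀ k ≤ 8, l ^ k ≤ l ^ 8 := fun k hk => Nat.pow_le_pow_right (by omega) hk
  calc _ ≤ l + 2 * (l * l ^ 2) + 2 * (l * (l * l ^ 2 * (l + l * (l * l ^ 2 + 1) + 1))) := by gcongr
    _ = l ^ 1 + 2 * l ^ 3 + 2 * l ^ 8 + 4 * l ^ 5 + 2 * l ^ 4 := by ring
    _ ≤ 2 ^ 4 * l ^ 8 := by
      have := h1 1 (by norm_num)
      have := h1 3 (by norm_num)
      have := h1 5 (by norm_num)
      have := h1 4 (by norm_num)
      omega
    _ ≤ l ^ 4 * l ^ 8 := Nat.mul_le_mul_right _ (Nat.pow_le_pow_left hl 4)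
    _ = l ^ 12 := by ring

lemma mul_le_two_pow {r : ℕ} (hr : 30 ≤ r) : 2 ^ 20 * r ≤ 2 ^ r := by
  induction r, hr using Nat.le_induction with
  | base => norm_num
  | succ n hn ih =>
    rw [pow_succ]
    omega

lemma spread_exponent_le (r : ℕ) :
    (2 ^ r) ^ 4 * ((2 ^ r) ^ 2 + 3) ^ 2 ^ r ≤ 2 ^ (4 * r + (2 * r + 2) * 2 ^ r) := by
  have h1 : (2 ^ r) ^ 2 + 3 ≤ 2 ^ (2 * r + 2) := by
    have h2 : 1 ≤ (2 ^ r) ^ 2 := Nat.one_le_pow _ _ (by positivity)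
    calc (2 ^ r) ^ 2 + 3 ≤ (2 ^ r) ^ 2 * 4 := by omega
      _ = 2 ^ (2 * r + 2) := by ring
  calc _ ≤ (2 ^ r) ^ 4 * (2 ^ (2 * r + 2)) ^ 2 ^ r := by gcongr
    _ = _ := by rw [← pow_mul, ← pow_mul, ← pow_add, mul_comm r 4]

lemma HasDesign.exists_div_eq {g : ℚ} (h : HasDesign g) (n₀ : ℕ) :
    ∃ n, n₀ < n ∧ (d (n + 1) : ℚ) / d n = g := by
  obtain ⟨b, c, h⟩ := h.exists_residues
  obtain ⟨s, hs⟩ : ∃ s, s = b ^ 2 * (c + 2) + n₀ := ⟨_, rfl⟩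
  obtain ⟨r, hr⟩ : ∃ r, r = s + 30 := ⟨_, rfl⟩
  obtain ⟨N, hN⟩ : ∃ N, N = 2 ^ r := ⟨_, rfl⟩
  obtain ⟨k, hk⟩ : ∃ k, k = 4 * r + (2 * r + 2) * N := ⟨_, rfl⟩
  obtain ⟨l, hl⟩ : ∃ l, l = 2 ^ k := ⟨_, rfl⟩
  have hrN : 2 ^ 20 * r ≤ N := hN ▸ mul_le_two_pow (by omega)
  obtain ⟨Q, ρ, V, hQ0, hQp, hQle, hVQ, hV, hD⟩ := h N
  have hQ2 : 2 ∣ Q := hQp 2 (by omega) Nat.prime_two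
  have hQ3 : 3 ∣ Q := hQp 3 (by omega) Nat.prime_three
  have hQN : Q ≤ 2 ^ N ^ 4 := by
    refine hQle.trans (Nat.pow_le_pow_right two_pos ?_)
    have h1 : b ^ 2 * (c + 2) ≤ N := by omega
    have h2 : c + N + 1 ≤ (c + 2) * N := by nlinarith
    calc (b * N) ^ 2 * (c + N + 1) ≤ (b * N) ^ 2 * ((c + 2) * N) := Nat.mul_le_mul_left _ h2
      _ = N ^ 3 * (b ^ 2 * (c + 2)) := by ring
      _ ≤ N ^ 3 * N := Nat.mul_le_mul_left _ h1
      _ = N ^ 4 := by ring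
  have hexp : N ^ 4 * (N ^ 2 + 3) ^ N ≤ l := by
    rw [hl, hk, hN]
    exact spread_exponent_le r
  have hN4 : N ^ 4 ≤ l := (Nat.le_mul_of_pos_right _ (by positivity)).trans hexp
  have hNl : N ≤ l := (Nat.le_self_pow (by norm_num) N).trans hN4
  obtain ⟨a, hmod, hmono, hlt, huniq⟩ := exists_spread ρ hQ0 hQN
    (Nat.le_self_pow (pow_ne_zero 4 (by omega)) 2) hQp N le_rfl
  have hltl : ∀ i < N, a i < 2 ^ l := fun i hi => (hlt i hi).trans_le (by
    rw [← pow_mul]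
    exact Nat.pow_le_pow_right two_pos hexp)
  obtain ⟨M, A, B, K, hcfg, hQM, hM0, hM, hB⟩ := exists_linearConfig hQ0 hQ2
    (hQN.trans (Nat.pow_le_pow_right two_pos hN4)) hVQ hV hD hmod hmono hltl huniq
  have hl12 : l ^ 12 = 2 ^ (12 * k) := by rw [hl, ← pow_mul, mul_comm]
  have hM' : M ≤ 2 ^ 2 ^ (12 * k) := hl12 ▸ hM.trans
    (Nat.pow_le_pow_right two_pos (config_exponent_le (by omega) hNl))
  have hBM : ∀ i < N, B i ≤ (2 ^ 2 ^ (12 * k)) ^ 2 := fun i hi => by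
    refine (hB i hi).trans ?_
    rw [← hl12] at hM' ⊢
    have h1 : N + 2 ≤ 2 ^ l := by
      have : N < 2 ^ N := Nat.lt_two_pow_self
      have : N + 1 ≤ l := by
        have : N * 2 ≤ N * N ^ 3 := Nat.mul_le_mul_left _
          ((by omega : 2 ≤ N).trans (Nat.le_self_pow (by norm_num) N))
        have : N * N ^ 3 = N ^ 4 := by ring
        omega
      have := (Nat.lt_two_pow_self (n := l))
      omega
    have h2 : 2 ^ (l * 2) ≤ 2 ^ l ^ 12 := by
      refine Nat.pow_le_pow_right two_pos ?_
      calc l * 2 ≤ l * l ^ 11 := Nat.mul_le_mul_left _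
            ((by omega : 2 ≤ l).trans (Nat.le_self_pow (by norm_num) l))
        _ = l ^ 12 := by ring
    have h3 : 2 ^ l ≤ 2 ^ l ^ 12 := Nat.pow_le_pow_right two_pos (Nat.le_self_pow (by norm_num) l)
    calc M * (N + 1) + 2 ^ l ≤ 2 ^ l ^ 12 * (N + 1) + 2 ^ l ^ 12 := by gcongr
      _ = 2 ^ l ^ 12 * (N + 2) := by ring
      _ ≤ 2 ^ l ^ 12 * 2 ^ l ^ 12 := Nat.mul_le_mul_left _ (h1.trans h3)
      _ = _ := by ring
  obtain ⟨R, hR⟩ : ∃ R, R = 2 ^ (s + 27) := ⟨_, rfl⟩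
  have hNR : N = 8 * R := by rw [hN, hr, hR]; ring
  have hk4 : 32 * (12 * k + 4) ≤ R ^ 2 := by
    have h1 : 2 ^ 17 * r ≤ R := by omega
    have h2 : 1 ≤ r := by omega
    rw [hk, hNR]
    nlinarith
  obtain ⟨t, i, j, hij, hj, hdt⟩ := exists_d_linear_eq
    ((Nat.Coprime.mul_dvd_of_dvd_of_dvd (by norm_num) hQ2 hQ3).trans hQM) hM0 hM'
    (fun i hi => ⟨K i, by rw [mul_comm, hcfg.mul_eq i hi]⟩) hcfg.dvd_of_dvd hcfg.coprime
    (fun i hi => (by omega : 0 < N).trans_le (hcfg.le i hi)) hBM hk4 (by omega)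
  obtain ⟨n, hn, hng⟩ := hcfg.exists_div_eq hM0 hij hj hdt
    ((by omega : 0 < N).trans_le (hcfg.le i (hij.trans hj)))
  exact ⟨n, by omega, hng⟩

/-- `R` contains the subgroup `G` generated by the values `f x y`. -/
theorem stmt_11 : ∀ g : Qpos, g ∈ G → (g : ℚ) ∈ R := by
  intro g hg
  refine Set.infinite_of_forall_exists_gt fun n₀ => ?_
  obtain ⟨n, hn, hng⟩ := (hasDesign_of_mem_G g hg).exists_div_eq n₀
  exact ⟨n, ⟨by omega, hng⟩, hn⟩
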